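/- arXiv:2605.10015 — 9 statements merged into one kernel-verified Lean document; each statement's English description precedes it below -/
import Mathlib

section
/- Let X be a measurable space and let M be a map sending each probability measure μ on X to a probability measure M[μ] on X. Then M satisfies ε-local differential privacy (i.e., for all probability measures μ, μ' on X and all measurable sets S, M[μ](S) ≤ e^ε · M[μ'](S)) if and only if there exists a finite measure m on X (not necessarily a probability measure) such that for every probability measure μ on X and every measurable set S, e^{-ε/2} · m(S) ≤ M[μ](S) ≤ e^{ε/2} · m(S). -/
open MeasureTheory

/-- A mechanism `M` mapping probability measures to probability measures
satisfies `ε`-local differential privacy iff there exists a finite base measure `m`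
such that `e^{-ε/2}·m(S) ≤ M[μ](S) ≤ e^{ε/2}·m(S)` for all probability measures `μ`
and measurable sets `S`. -/
theorem ldp_iff_exists_base_measure {X : Type*} [MeasurableSpace X]
    (ε : ℝ) (hε : 0 < ε)
    (M : Measure X → Measure X)
    (hM : ∀ μ : Measure X, IsProbabilityMeasure μ → IsProbabilityMeasure (M μ)) :
    (∀ μ μ' : Measure X, IsProbabilityMeasure μ → IsProbabilityMeasure μ' →
      ∀ S : Set X, MeasurableSet S →
        M μ S ≤ ENNReal.ofReal (Real.exp ε) * M μ' S)
    ↔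
    (∃ m : Measure X, IsFiniteMeasure m ∧
      ∀ μ : Measure X, IsProbabilityMeasure μ → ∀ S : Set X, MeasurableSet S →
        ENNReal.ofReal (Real.exp (-ε / 2)) * m S ≤ M μ S ∧
        M μ S ≤ ENNReal.ofReal (Real.exp (ε / 2)) * m S) := by
  have hexp : ∀ a b : ℝ, ENNReal.ofReal (Real.exp a) * ENNReal.ofReal (Real.exp b) =
      ENNReal.ofReal (Real.exp (a + b)) := fun a b => by
    rw [← ENNReal.ofReal_mul (Real.exp_pos a).le, ← Real.exp_add]
  constructor
  · intro h
    by_cases hne : ∃ μ₀ : Measure X, IsProbabilityMeasure μ₀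
    · obtain ⟨μ₀, hμ₀⟩ := hne
      have := hM μ₀ hμ₀
      set ν : Measure X := sInf {ρ | ∃ μ, IsProbabilityMeasure μ ∧ ρ = M μ}
      have hν_le : ∀ μ, IsProbabilityMeasure μ → ν ≤ M μ := fun μ hμ => sInf_le ⟨μ, hμ, rfl⟩
      have hle_ν : ∀ μ, IsProbabilityMeasure μ → ENNReal.ofReal (Real.exp (-ε)) • M μ ≤ ν := by
        intro μ hμ
        refine le_sInf ?_
        rintro _ ⟨μ', hμ', rfl⟩
        refine Measure.le_iff.2 fun S hS => ?_
        calc ENNReal.ofReal (Real.exp (-ε)) * M μ S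
            ≤ ENNReal.ofReal (Real.exp (-ε)) * (ENNReal.ofReal (Real.exp ε) * M μ' S) := by
              gcongr
              exact h μ μ' hμ hμ' S hS
          _ = M μ' S := by rw [← mul_assoc, hexp]; simp
      have : IsFiniteMeasure ν := isFiniteMeasure_of_le (M μ₀) (hν_le μ₀ hμ₀)
      refine ⟨ENNReal.ofReal (Real.exp (ε / 2)) • ν, ν.smul_finite ENNReal.ofReal_ne_top,
        fun μ hμ S hS => ⟨?_, ?_⟩⟩
      · rw [Measure.smul_apply, smul_eq_mul, ← mul_assoc, hexp, neg_div, neg_add_cancel]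
        simpa using hν_le μ hμ S
      · rw [Measure.smul_apply, smul_eq_mul, ← mul_assoc, hexp, add_halves]
        calc M μ S = ENNReal.ofReal (Real.exp ε) *
              (ENNReal.ofReal (Real.exp (-ε)) * M μ S) := by rw [← mul_assoc, hexp]; simp
          _ ≤ ENNReal.ofReal (Real.exp ε) * ν S := by
              gcongr
              exact hle_ν μ hμ S
    · exact ⟨0, inferInstance, fun μ hμ => (hne ⟨μ, hμ⟩).elim⟩
  · rintro ⟨m, -, h⟩ μ μ' hμ hμ' S hS
    calc M μ S ≤ ENNReal.ofReal (Real.exp (ε / 2)) * m S := (h μ hμ S hS).2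
      _ = ENNReal.ofReal (Real.exp ε) * (ENNReal.ofReal (Real.exp (-ε / 2)) * m S) := by
          rw [← mul_assoc, hexp]
          ring_nf
      _ ≤ ENNReal.ofReal (Real.exp ε) * M μ' S := by
          gcongr
          exact (h μ' hμ' S hS).1
end

section
/- There exists a nonnegative vector m* ∈ ℝ_{≥0}^{k_v} with Q_{m*,ε} nonempty such that for every map M from probability vectors on [k] to probability vectors on [k_v] satisfying ε-LDP, sup over probability vectors μ on [k] of OT(M[μ], μ) is at least sup over probability vectors μ on [k] of inf_{ν ∈ Q_{m*,ε}} OT(ν, μ). In other words, the Wasserstein projection mechanism with base measure m* is minimax optimal among ε-LDP mechanisms for worst-case optimal transport cost. -/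
open Finset

/-- A probability vector on `Fin n`. -/
def IsProbVec {n : ℕ} (μ : Fin n → ℝ) : Prop :=
  (∀ i, 0 ≤ μ i) ∧ ∑ i, μ i = 1

/-- Discrete optimal transport cost between `ν` (on `Fin kv`) and `μ` (on `Fin k`)
with cost matrix `C`. -/
noncomputable def OT {k kv : ℕ} (C : Fin k → Fin kv → ℝ)
    (ν : Fin kv → ℝ) (μ : Fin k → ℝ) : ℝ :=
  sInf {c | ∃ π : Fin k → Fin kv → ℝ,
    (∀ i j, 0 ≤ π i j) ∧ (∀ i, ∑ j, π i j = μ i) ∧ (∀ j, ∑ i, π i j = ν j) ∧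
    c = ∑ i, ∑ j, C i j * π i j}

/-- The LDP polytope `Q_{m,ε}`. -/
def LDPpolytope {kv : ℕ} (ε : ℝ) (m : Fin kv → ℝ) : Set (Fin kv → ℝ) :=
  {ν | IsProbVec ν ∧ ∀ j, Real.exp (-ε / 2) * m j ≤ ν j ∧ ν j ≤ Real.exp (ε / 2) * m j}


lemma IsProbVec.le_one {n : ℕ} {μ : Fin n → ℝ} (h : IsProbVec μ) (i : Fin n) : μ i ≤ 1 :=
  h.2 ▸ single_le_sum (fun j _ => h.1 j) (mem_univ i)

lemma isProbVec_single {n : ℕ} (i : Fin n) : IsProbVec (Pi.single i (1 : ℝ)) := by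
  refine ⟨fun j => ?_, by simp⟩
  by_cases h : j = i
  · subst h; simp
  · simp [h]

/-- Pairs of a base measure `m` and a transport plan of cost at most `c` from `μ` to some
element of `LDPpolytope ε m`. -/
def feasiblePlans {k kv : ℕ} (ε : ℝ) (C : Fin k → Fin kv → ℝ) (μ : Fin k → ℝ) (c : ℝ) :
    Set ((Fin kv → ℝ) × (Fin k → Fin kv → ℝ)) :=
  {p | (∀ j, 0 ≤ p.1 j) ∧ (∀ i j, 0 ≤ p.2 i j) ∧ (∀ i, ∑ j, p.2 i j = μ i) ∧
    (∀ j, Real.exp (-ε / 2) * p.1 j ≤ ∑ i, p.2 i j) ∧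
    (∀ j, ∑ i, p.2 i j ≤ Real.exp (ε / 2) * p.1 j) ∧ ∑ i, ∑ j, C i j * p.2 i j ≤ c}

/-- Base measures for which every `μ` is within transport cost `c` of the LDP polytope. -/
def feasibleBases {k kv : ℕ} (ε : ℝ) (C : Fin k → Fin kv → ℝ) (c : ℝ) : Set (Fin kv → ℝ) :=
  ⋂ μ : {μ : Fin k → ℝ // IsProbVec μ}, Prod.fst '' feasiblePlans ε C μ c

section

variable {k kv : ℕ} {ε : ℝ} {C : Fin k → Fin kv → ℝ}

lemma isProbVec_colSum {μ : Fin k → ℝ} (hμ : IsProbVec μ) {π : Fin k → Fin kv → ℝ}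
    (h0 : ∀ i j, 0 ≤ π i j) (hrow : ∀ i, ∑ j, π i j = μ i) :
    IsProbVec (fun j => ∑ i, π i j) := by
  refine ⟨fun j => sum_nonneg fun i _ => h0 i j, ?_⟩
  rw [sum_comm]
  simp only [hrow, hμ.2]

lemma isCompact_feasiblePlans {μ : Fin k → ℝ} (hμ : IsProbVec μ) (c : ℝ) :
    IsCompact (feasiblePlans ε C μ c) := by
  have hclosed : IsClosed (feasiblePlans ε C μ c) := by
    simp only [feasiblePlans, Set.ofPred_and, Set.ofPred_forall]
    refine (isClosed_iInter fun j => ?_).inter <|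
      (isClosed_iInter fun i => isClosed_iInter fun j => ?_).inter <|
      (isClosed_iInter fun i => ?_).inter <| (isClosed_iInter fun j => ?_).inter <|
      (isClosed_iInter fun j => ?_).inter ?_
    · exact isClosed_le (by fun_prop) (by fun_prop)
    · exact isClosed_le (by fun_prop) (by fun_prop)
    · exact isClosed_eq (by fun_prop) (by fun_prop)
    · exact isClosed_le (by fun_prop) (by fun_prop)
    · exact isClosed_le (by fun_prop) (by fun_prop)
    · exact isClosed_le (by fun_prop) (by fun_prop)
  refine (isCompact_Icc (a := 0)
    (b := ((fun _ => Real.exp (ε / 2)), (fun _ _ => 1)))).of_isClosed_subset hclosed ?_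
  rintro ⟨m, π⟩ ⟨hm, h0, hrow, hlow, -, -⟩
  refine ⟨⟨hm, h0⟩, fun j => ?_, fun i j => ?_⟩
  · have h := (hlow j).trans ((isProbVec_colSum hμ h0 hrow).le_one j)
    have h' := mul_le_mul_of_nonneg_left h (Real.exp_pos (ε / 2)).le
    rw [← mul_assoc, ← Real.exp_add] at h'
    simpa [neg_div] using h'
  · exact (single_le_sum (fun j _ => h0 i j) (mem_univ j)).trans
      ((hrow i).trans_le (hμ.le_one i))

lemma isClosed_feasibleBases (c : ℝ) : IsClosed (feasibleBases ε C c) :=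
  isClosed_iInter fun μ => ((isCompact_feasiblePlans μ.2 c).image continuous_fst).isClosed

lemma isCompact_feasibleBases (hk : 0 < k) (c : ℝ) : IsCompact (feasibleBases ε C c) :=
  ((isCompact_feasiblePlans (isProbVec_single (⟨0, hk⟩ : Fin k)) c).image
    continuous_fst).of_isClosed_subset (isClosed_feasibleBases c)
      (Set.iInter_subset (fun μ : {μ : Fin k → ℝ // IsProbVec μ} =>
        Prod.fst '' feasiblePlans ε C μ c) ⟨_, isProbVec_single ⟨0, hk⟩⟩)

lemma feasibleBases_mono : Monotone (feasibleBases ε C) := fun _ _ h =>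
  Set.iInter_mono fun _ => Set.image_mono fun _ ⟨h1, h2, h3, h4, h5, h6⟩ =>
    ⟨h1, h2, h3, h4, h5, h6.trans h⟩

lemma exists_base_mem_LDPpolytope (hk : 0 < k) {M : (Fin k → ℝ) → (Fin kv → ℝ)}
    (hM : ∀ μ, IsProbVec μ → IsProbVec (M μ))
    (hLDP : ∀ μ μ', IsProbVec μ → IsProbVec μ' → ∀ j, M μ j ≤ Real.exp ε * M μ' j) :
    ∃ m : Fin kv → ℝ, (∀ j, 0 ≤ m j) ∧ ∀ μ, IsProbVec μ → M μ ∈ LDPpolytope ε m := by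
  have : Nonempty {μ : Fin k → ℝ // IsProbVec μ} := ⟨⟨_, isProbVec_single ⟨0, hk⟩⟩⟩
  let a : Fin kv → ℝ := fun j => ⨅ μ : {μ : Fin k → ℝ // IsProbVec μ}, M μ j
  have ha : ∀ j, 0 ≤ a j := fun j => Real.iInf_nonneg fun μ => (hM μ μ.2).1 j
  refine ⟨fun j => Real.exp (ε / 2) * a j, fun j => mul_nonneg (Real.exp_pos _).le (ha j),
    fun μ hμ => ⟨hM μ hμ, fun j => ⟨?_, ?_⟩⟩⟩
  · rw [← mul_assoc, ← Real.exp_add, neg_div, neg_add_cancel, Real.exp_zero, one_mul]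
    exact ciInf_le (f := fun μ : {μ : Fin k → ℝ // IsProbVec μ} => M μ j)
      ⟨0, by rintro _ ⟨μ, rfl⟩; exact (hM μ μ.2).1 j⟩ ⟨μ, hμ⟩
  · rw [← mul_assoc, ← Real.exp_add, add_halves]
    refine (div_le_iff₀' (Real.exp_pos ε)).1 (le_ciInf fun μ' => ?_)
    exact (div_le_iff₀' (Real.exp_pos ε)).2 (hLDP μ μ' hμ μ'.2 j)

lemma exists_plan_of_OT_lt {ν : Fin kv → ℝ} {μ : Fin k → ℝ} (hν : IsProbVec ν)
    (hμ : IsProbVec μ) {c : ℝ} (h : OT C ν μ < c) :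
    ∃ π : Fin k → Fin kv → ℝ, (∀ i j, 0 ≤ π i j) ∧ (∀ i, ∑ j, π i j = μ i) ∧
      (∀ j, ∑ i, π i j = ν j) ∧ ∑ i, ∑ j, C i j * π i j < c := by
  have hne : {c | ∃ π : Fin k → Fin kv → ℝ,
      (∀ i j, 0 ≤ π i j) ∧ (∀ i, ∑ j, π i j = μ i) ∧ (∀ j, ∑ i, π i j = ν j) ∧
      c = ∑ i, ∑ j, C i j * π i j}.Nonempty :=
    ⟨_, fun i j => μ i * ν j, fun i j => mul_nonneg (hμ.1 i) (hν.1 j),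
      fun i => by rw [← mul_sum, hν.2, mul_one], fun j => by rw [← sum_mul, hμ.2, one_mul], rfl⟩
  obtain ⟨_, ⟨π, h0, hrow, hcol, rfl⟩, hlt⟩ := exists_lt_of_csInf_lt hne h
  exact ⟨π, h0, hrow, hcol, hlt⟩

lemma cost_nonneg (hC : ∀ i j, 0 ≤ C i j) {π : Fin k → Fin kv → ℝ} (h0 : ∀ i j, 0 ≤ π i j) :
    0 ≤ ∑ i, ∑ j, C i j * π i j :=
  sum_nonneg fun i _ => sum_nonneg fun j _ => mul_nonneg (hC i j) (h0 i j)

lemma OT_nonneg (hC : ∀ i j, 0 ≤ C i j) (ν : Fin kv → ℝ) (μ : Fin k → ℝ) : 0 ≤ OT C ν μ :=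
  Real.sInf_nonneg (by rintro _ ⟨π, h0, -, -, rfl⟩; exact cost_nonneg hC h0)

lemma OT_le_cost (hC : ∀ i j, 0 ≤ C i j) {π : Fin k → Fin kv → ℝ} (h0 : ∀ i j, 0 ≤ π i j)
    {ν : Fin kv → ℝ} {μ : Fin k → ℝ} (hrow : ∀ i, ∑ j, π i j = μ i)
    (hcol : ∀ j, ∑ i, π i j = ν j) : OT C ν μ ≤ ∑ i, ∑ j, C i j * π i j :=
  csInf_le ⟨0, by rintro _ ⟨π, h0, -, -, rfl⟩; exact cost_nonneg hC h0⟩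
    ⟨π, h0, hrow, hcol, rfl⟩

lemma OT_le_sum (hC : ∀ i j, 0 ≤ C i j) {ν : Fin kv → ℝ} {μ : Fin k → ℝ} (hν : IsProbVec ν)
    (hμ : IsProbVec μ) : OT C ν μ ≤ ∑ i, ∑ j, C i j := by
  refine (OT_le_cost hC (π := fun i j => μ i * ν j) (fun i j => mul_nonneg (hμ.1 i) (hν.1 j))
    (fun i => by rw [← mul_sum, hν.2, mul_one])
    (fun j => by rw [← sum_mul, hμ.2, one_mul])).trans ?_
  refine sum_le_sum fun i _ => sum_le_sum fun j _ => mul_le_of_le_one_right (hC i j) ?_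
  exact mul_le_one₀ (hμ.le_one i) (hν.1 j) (hν.le_one j)

lemma feasibleBases_nonempty (hk : 0 < k) {M : (Fin k → ℝ) → (Fin kv → ℝ)}
    (hM : ∀ μ, IsProbVec μ → IsProbVec (M μ))
    (hLDP : ∀ μ μ', IsProbVec μ → IsProbVec μ' → ∀ j, M μ j ≤ Real.exp ε * M μ' j)
    {c : ℝ} (hc : ∀ μ, IsProbVec μ → OT C (M μ) μ < c) : (feasibleBases ε C c).Nonempty := by
  obtain ⟨m, hm, hmem⟩ := exists_base_mem_LDPpolytope hk hM hLDP
  refine ⟨m, Set.mem_iInter.2 fun μ => ?_⟩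
  obtain ⟨π, h0, hrow, hcol, hlt⟩ := exists_plan_of_OT_lt (hM μ μ.2) μ.2 (hc μ μ.2)
  exact ⟨(m, π), ⟨hm, h0, hrow, fun j => (hcol j).symm ▸ ((hmem μ μ.2).2 j).1,
    fun j => (hcol j).symm ▸ ((hmem μ μ.2).2 j).2, hlt.le⟩, rfl⟩

lemma exists_mem_LDPpolytope_OT_le (hC : ∀ i j, 0 ≤ C i j) {m : Fin kv → ℝ} {c : ℝ}
    (h : m ∈ feasibleBases ε C c) {μ : Fin k → ℝ} (hμ : IsProbVec μ) :
    (∀ j, 0 ≤ m j) ∧ ∃ ν ∈ LDPpolytope ε m, OT C ν μ ≤ c := by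
  obtain ⟨⟨m, π⟩, ⟨hm, h0, hrow, hlow, hup, hcost⟩, rfl⟩ := Set.mem_iInter.1 h ⟨μ, hμ⟩
  exact ⟨hm, _, ⟨isProbVec_colSum hμ h0 hrow, fun j => ⟨hlow j, hup j⟩⟩,
    (OT_le_cost hC h0 hrow fun _ => rfl).trans hcost⟩

/-- A single base measure is feasible at every cost level at which some base measure is. -/
lemma exists_mem_feasibleBases (hk : 0 < k) (hne : ∃ c, (feasibleBases ε C c).Nonempty) :
    ∃ m, ∀ c, (feasibleBases ε C c).Nonempty → m ∈ feasibleBases ε C c := by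
  have : Nonempty {c // (feasibleBases ε C c).Nonempty} := nonempty_subtype.2 hne
  obtain ⟨m, hm⟩ := IsCompact.nonempty_iInter_of_directed_nonempty_isCompact_isClosed
    (fun c : {c // (feasibleBases ε C c).Nonempty} => feasibleBases ε C c)
    (Monotone.directed_ge fun _ _ h => feasibleBases_mono h) (fun c => c.2)
    (fun c => isCompact_feasibleBases hk c) (fun c => isClosed_feasibleBases c)
  exact ⟨m, fun c hc => Set.mem_iInter.1 hm ⟨c, hc⟩⟩

end

/-- There exists a base measure `m*` with nonempty LDP polytope such that
the Wasserstein projection mechanism with base measure `m*` is minimax optimal among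
ε-LDP mechanisms for worst-case optimal transport cost. -/
theorem wpm_minimax_optimal {k kv : ℕ} (hk : 0 < k) (hkv : 0 < kv)
    (ε : ℝ) (hε : 0 < ε)
    (C : Fin k → Fin kv → ℝ) (hC : ∀ i j, 0 ≤ C i j) :
    ∃ m : Fin kv → ℝ, (∀ j, 0 ≤ m j) ∧ (LDPpolytope ε m).Nonempty ∧
      ∀ M : (Fin k → ℝ) → (Fin kv → ℝ),
        (∀ μ, IsProbVec μ → IsProbVec (M μ)) →
        (∀ μ μ', IsProbVec μ → IsProbVec μ' → ∀ j, M μ j ≤ Real.exp ε * M μ' j) →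
        sSup {x | ∃ μ, IsProbVec μ ∧
            x = sInf ((fun ν => OT C ν μ) '' LDPpolytope ε m)} ≤
          sSup {x | ∃ μ, IsProbVec μ ∧ x = OT C (M μ) μ} := by
  have hμ₀ := isProbVec_single (⟨0, hk⟩ : Fin k)
  have hν₀ := isProbVec_single (⟨0, hkv⟩ : Fin kv)
  have hne : ∃ c, (feasibleBases ε C c).Nonempty :=
    ⟨_, feasibleBases_nonempty hk (M := fun _ => Pi.single ⟨0, hkv⟩ 1) (fun _ _ => hν₀)
      (fun _ _ _ _ j => le_mul_of_one_le_left (hν₀.1 j) (Real.one_le_exp hε.le))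
      fun _ hμ => (OT_le_sum hC hν₀ hμ).trans_lt (lt_add_one _)⟩
  obtain ⟨m, hm⟩ := exists_mem_feasibleBases hk hne
  obtain ⟨c₀, hc₀⟩ := hne
  obtain ⟨hm0, ν, hν, -⟩ := exists_mem_LDPpolytope_OT_le hC (hm c₀ hc₀) hμ₀
  refine ⟨m, hm0, ⟨ν, hν⟩, fun M hM hLDP => le_of_forall_gt_imp_ge_of_dense fun c hc => ?_⟩
  have hbdd : BddAbove {x | ∃ μ, IsProbVec μ ∧ x = OT C (M μ) μ} :=
    ⟨∑ i, ∑ j, C i j, by rintro _ ⟨μ, hμ, rfl⟩; exact OT_le_sum hC (hM μ hμ) hμ⟩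
  have hmc := hm c <| feasibleBases_nonempty hk hM hLDP fun μ hμ =>
    (le_csSup hbdd ⟨μ, hμ, rfl⟩).trans_lt hc
  refine csSup_le ⟨_, _, hμ₀, rfl⟩ ?_
  rintro _ ⟨μ, hμ, rfl⟩
  obtain ⟨-, ν, hν, hle⟩ := exists_mem_LDPpolytope_OT_le hC hmc hμ
  refine (csInf_le ⟨0, ?_⟩ (Set.mem_image_of_mem _ hν)).trans hle
  rintro _ ⟨ν', -, rfl⟩
  exact OT_nonneg hC ν' μ
end

section
/- Let m ∈ ℝ_{≥0}^{k_v} be such that Q_{m,ε} is nonempty, and let M be a map sending each probability vector μ on [k] to an element M[μ] ∈ Q_{m,ε} that minimizes OT(·, μ) over Q_{m,ε} (a Wasserstein projection mechanism). Then the supremum over all probability vectors μ on [k] of OT(M[μ], μ) equals the maximum over i ∈ [k] of OT(M[δ_i], δ_i), where δ_i is the Dirac probability vector concentrated at i. That is, the worst-case transport cost of a Wasserstein projection mechanism is attained at Dirac inputs. -/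
open Finset

/-- The Dirac probability vector at `i`. -/
def diracVec {n : ℕ} (i : Fin n) : Fin n → ℝ := fun l => if l = i then 1 else 0

theorem isProbVec_diracVec {n : ℕ} (i : Fin n) : IsProbVec (diracVec i) := by
  refine ⟨fun l => ?_, by simp [diracVec]⟩
  unfold diracVec
  split_ifs <;> norm_num

/-- Any coupling bounds the transport cost from above. -/
theorem OT_le_of_coupling {k kv : ℕ} {C : Fin k → Fin kv → ℝ} (hC : ∀ i j, 0 ≤ C i j)
    {ν : Fin kv → ℝ} {μ : Fin k → ℝ} {π : Fin k → Fin kv → ℝ} (hπ : ∀ i j, 0 ≤ π i j)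
    (hrow : ∀ i, ∑ j, π i j = μ i) (hcol : ∀ j, ∑ i, π i j = ν j) :
    OT C ν μ ≤ ∑ i, ∑ j, C i j * π i j := by
  refine csInf_le ⟨0, ?_⟩ ⟨π, hπ, hrow, hcol, rfl⟩
  rintro _ ⟨ρ, hρ, -, -, rfl⟩
  exact sum_nonneg fun i _ => sum_nonneg fun j _ => mul_nonneg (hC i j) (hρ i j)

/-- The only coupling with a Dirac vector is the product one. -/
theorem sum_cost_le_OT_diracVec {k kv : ℕ} (C : Fin k → Fin kv → ℝ) {ν : Fin kv → ℝ}
    (hν : IsProbVec ν) (i : Fin k) : ∑ j, C i j * ν j ≤ OT C ν (diracVec i) := by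
  refine le_csInf ⟨_, fun l j => diracVec i l * ν j, fun l j => ?_, fun l => ?_, fun j => ?_, rfl⟩ ?_
  · exact mul_nonneg ((isProbVec_diracVec i).1 l) (hν.1 j)
  · rw [← mul_sum, hν.2, mul_one]
  · rw [← sum_mul, (isProbVec_diracVec i).2, one_mul]
  · rintro _ ⟨π, hπ, hrow, hcol, rfl⟩
    have hzero : ∀ l, l ≠ i → ∀ j, π l j = 0 := fun l hl j => by
      have hsum : ∑ j, π l j = 0 := by rw [hrow l, diracVec, if_neg hl]
      exact (sum_eq_zero_iff_of_nonneg fun j _ => hπ l j).1 hsum j (mem_univ j)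
    have hdirac : ∀ j, π i j = ν j := fun j => by
      rw [← hcol j, sum_eq_single i (fun l _ hl => hzero l hl j) (by simp)]
    rw [sum_eq_single i (fun l _ hl => sum_eq_zero fun j _ => by rw [hzero l hl j, mul_zero])
      (by simp)]
    simp [hdirac]

/-- The LDP polytope is closed under mixtures. -/
theorem mixture_mem_LDPpolytope {k kv : ℕ} {ε : ℝ} {m : Fin kv → ℝ} {μ : Fin k → ℝ}
    (hμ : IsProbVec μ) {ν : Fin k → Fin kv → ℝ} (hν : ∀ i, ν i ∈ LDPpolytope ε m) :
    (fun j => ∑ i, μ i * ν i j) ∈ LDPpolytope ε m := by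
  refine ⟨⟨fun j => sum_nonneg fun i _ => mul_nonneg (hμ.1 i) ((hν i).1.1 j), ?_⟩,
    fun j => ⟨?_, ?_⟩⟩
  · rw [sum_comm]
    simp_rw [← mul_sum, (hν _).1.2, mul_one]
    exact hμ.2
  · rw [← one_mul (_ * m j), ← hμ.2, sum_mul]
    exact sum_le_sum fun i _ => mul_le_mul_of_nonneg_left ((hν i).2 j).1 (hμ.1 i)
  · rw [← one_mul (_ * m j), ← hμ.2, sum_mul]
    exact sum_le_sum fun i _ => mul_le_mul_of_nonneg_left ((hν i).2 j).2 (hμ.1 i)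

/-- The worst-case transport cost of a Wasserstein projection mechanism
is attained at Dirac inputs. -/
theorem wpm_worst_case_at_diracs {k kv : ℕ} (hk : 0 < k)
    (ε : ℝ) (hε : 0 < ε)
    (C : Fin k → Fin kv → ℝ) (hC : ∀ i j, 0 ≤ C i j)
    (m : Fin kv → ℝ) (hm : ∀ j, 0 ≤ m j)
    (hQ : (LDPpolytope ε m).Nonempty)
    (M : (Fin k → ℝ) → (Fin kv → ℝ))
    (hMproj : ∀ μ, IsProbVec μ → M μ ∈ LDPpolytope ε m ∧
      ∀ ν ∈ LDPpolytope ε m, OT C (M μ) μ ≤ OT C ν μ) :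
    sSup {x | ∃ μ, IsProbVec μ ∧ x = OT C (M μ) μ} =
      ⨆ i : Fin k, OT C (M (diracVec i)) (diracVec i) := by
  have : Nonempty (Fin k) := ⟨⟨0, hk⟩⟩
  have hbound : ∀ μ, IsProbVec μ →
      OT C (M μ) μ ≤ ⨆ i : Fin k, OT C (M (diracVec i)) (diracVec i) := fun μ hμ => by
    have hmem i := (hMproj _ (isProbVec_diracVec i)).1
    calc OT C (M μ) μ
        ≤ OT C (fun j => ∑ i, μ i * M (diracVec i) j) μ :=
          (hMproj μ hμ).2 _ (mixture_mem_LDPpolytope hμ hmem)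
      _ ≤ ∑ i, ∑ j, C i j * (μ i * M (diracVec i) j) :=
          OT_le_of_coupling hC (fun i j => mul_nonneg (hμ.1 i) ((hmem i).1.1 j))
            (fun i => by rw [← mul_sum, (hmem i).1.2, mul_one]) fun _ => rfl
      _ = ∑ i, μ i * ∑ j, C i j * M (diracVec i) j := by simp_rw [mul_sum, mul_left_comm]
      _ ≤ ∑ i, μ i * ⨆ i : Fin k, OT C (M (diracVec i)) (diracVec i) :=
          sum_le_sum fun i _ => mul_le_mul_of_nonneg_left
            ((sum_cost_le_OT_diracVec C (hmem i).1 i).trans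
              (le_ciSup (f := fun i => OT C (M (diracVec i)) (diracVec i))
                (Set.finite_range _).bddAbove i)) (hμ.1 i)
      _ = ⨆ i : Fin k, OT C (M (diracVec i)) (diracVec i) := by rw [← sum_mul, hμ.2, one_mul]
  apply le_antisymm
  · refine csSup_le ⟨_, _, isProbVec_diracVec ⟨0, hk⟩, rfl⟩ ?_
    rintro _ ⟨μ, hμ, rfl⟩
    exact hbound μ hμ
  · refine ciSup_le fun i => le_csSup
      ⟨⨆ i : Fin k, OT C (M (diracVec i)) (diracVec i), ?_⟩ ⟨_, isProbVec_diracVec i, rfl⟩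
    rintro _ ⟨μ, hμ, rfl⟩
    exact hbound μ hμ
end

section
/- Let α = e^{-ε/2}, β = e^{ε/2}, and let m ∈ ℝ_{≥0}^{k_v} satisfy α Σ_j m_j ≤ 1 ≤ β Σ_j m_j. Fix i ∈ [k] and define τ_i(m) := inf { t ∈ ℝ : Σ_{j=1}^{k_v} (β m_j 1_{C_{ij} ≤ t} + α m_j 1_{C_{ij} > t}) ≥ 1 }. Then the minimum of Σ_{j=1}^{k_v} C_{ij} q_j over probability vectors q ∈ Q_{m,ε} is attained and equals τ_i(m) + Σ_{j=1}^{k_v} ( α (C_{ij} − τ_i(m))_+ − β (τ_i(m) − C_{ij})_+ ) m_j, where (a)_+ := max(a, 0). -/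
open Finset

open Filter Topology in
/-- At the infimum of a nonempty, bounded below superlevel set of a finite monotone step sum, the
left limit is at most the level and the value is at least the level. -/
theorem step_sum_threshold {ι : Type*} [Fintype ι] (c a b : ι → ℝ) (hab : ∀ j, a j ≤ b j) (r : ℝ)
    (hne : {t : ℝ | r ≤ ∑ j, (if c j ≤ t then b j else a j)}.Nonempty)
    (hbdd : BddBelow {t : ℝ | r ≤ ∑ j, (if c j ≤ t then b j else a j)}) (τ : ℝ)
    (hτ : τ = sInf {t : ℝ | r ≤ ∑ j, (if c j ≤ t then b j else a j)}) :
    ∑ j, (if c j < τ then b j else a j) ≤ r ∧ r ≤ ∑ j, (if c j ≤ τ then b j else a j) := by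
  constructor
  · have hev : ∀ᶠ t in 𝓝[<] τ, ∀ j, (c j ≤ t ↔ c j < τ) := by
      rw [eventually_all]
      intro j
      by_cases h : c j < τ
      · filter_upwards [Ioo_mem_nhdsLT h] with t ht
        exact ⟨fun _ => h, fun _ => ht.1.le⟩
      · filter_upwards [self_mem_nhdsWithin] with t ht
        exact ⟨fun h' => lt_of_le_of_lt h' ht, fun h' => absurd h' h⟩
    obtain ⟨t, ht, htτ⟩ := (hev.and self_mem_nhdsWithin).exists
    have htS : t ∉ {t : ℝ | r ≤ ∑ j, (if c j ≤ t then b j else a j)} :=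
      notMem_of_lt_csInf (hτ ▸ htτ) hbdd
    simp only [Set.mem_ofPred_eq, not_le, ht] at htS
    exact htS.le
  · have hev : ∀ᶠ t in 𝓝[>] τ, ∀ j, (c j ≤ t ↔ c j ≤ τ) := by
      rw [eventually_all]
      intro j
      by_cases h : c j ≤ τ
      · filter_upwards [self_mem_nhdsWithin] with t ht
        exact ⟨fun _ => h, fun h' => h'.trans (le_of_lt ht)⟩
      · filter_upwards [Ioo_mem_nhdsGT (not_le.mp h)] with t ht
        exact ⟨fun h' => absurd h' (not_le.mpr ht.2), fun h' => absurd h' h⟩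
    obtain ⟨v, hv, hτv⟩ := (hev.and self_mem_nhdsWithin).exists
    obtain ⟨t, htS, htv⟩ := exists_lt_of_csInf_lt hne (hτ ▸ hτv)
    simp only [← hv]
    refine le_trans htS (Finset.sum_le_sum fun j _ => ?_)
    have := hab j
    split_ifs <;> linarith

/-- Closed form for the fractional-knapsack minimum of the linear cost
over the LDP polytope, with threshold `τ_i(m)`. -/
theorem knapsack_closed_form {k kv : ℕ} (ε : ℝ) (hε : 0 < ε)
    (C : Fin k → Fin kv → ℝ) (hC : ∀ i j, 0 ≤ C i j)
    (m : Fin kv → ℝ) (hm : ∀ j, 0 ≤ m j)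
    (hfeas : Real.exp (-ε / 2) * ∑ j, m j ≤ 1 ∧ 1 ≤ Real.exp (ε / 2) * ∑ j, m j)
    (i : Fin k)
    (τ : ℝ)
    (hτ : τ = sInf {t : ℝ | 1 ≤ ∑ j,
      (if C i j ≤ t then Real.exp (ε / 2) * m j else Real.exp (-ε / 2) * m j)}) :
    IsLeast {x | ∃ q ∈ LDPpolytope ε m, x = ∑ j, C i j * q j}
      (τ + ∑ j, (Real.exp (-ε / 2) * max (C i j - τ) 0
        - Real.exp (ε / 2) * max (τ - C i j) 0) * m j) := by
  set α := Real.exp (-ε / 2)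
  set β := Real.exp (ε / 2)
  have hα0 : 0 < α := Real.exp_pos _
  have hαβ : α ≤ β := Real.exp_le_exp.mpr (by linarith)
  have hab : ∀ j, α * m j ≤ β * m j := fun j => mul_le_mul_of_nonneg_right hαβ (hm j)
  have hthr : ∑ j, (if C i j < τ then β * m j else α * m j) ≤ 1 ∧
      1 ≤ ∑ j, (if C i j ≤ τ then β * m j else α * m j) := by
    have hlow : ∀ t, α * ∑ j, m j ≤ ∑ j, (if C i j ≤ t then β * m j else α * m j) := by
      intro t
      rw [Finset.mul_sum]
      refine Finset.sum_le_sum fun j _ => ?_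
      have := hab j
      split_ifs <;> linarith
    rcases hfeas.1.lt_or_eq with hlt | heq
    · refine step_sum_threshold (C i) _ _ hab 1 ?_ ?_ τ hτ
      · refine ⟨∑ j, C i j, ?_⟩
        have h : ∀ j, C i j ≤ ∑ j, C i j := fun j =>
          Finset.single_le_sum (fun l _ => hC i l) (Finset.mem_univ j)
        simpa only [Set.mem_ofPred_eq, h, if_true, ← Finset.mul_sum] using hfeas.2
      · refine ⟨0, fun t ht => ?_⟩
        by_contra! h0
        have h : ∀ j, ¬ C i j ≤ t := fun j => not_le.mpr (h0.trans_le (hC i j))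
        simp only [Set.mem_ofPred_eq, h, if_false, ← Finset.mul_sum] at ht
        linarith
    · have huniv : {t : ℝ | 1 ≤ ∑ j, (if C i j ≤ t then β * m j else α * m j)} = Set.univ :=
        Set.eq_univ_of_forall fun t => heq ▸ hlow t
      rw [huniv, Real.sInf_univ] at hτ
      refine ⟨?_, heq ▸ hlow τ⟩
      have h : ∀ j, ¬ C i j < τ := fun j => not_lt.mpr (hτ ▸ hC i j)
      simp only [h, if_false, ← Finset.mul_sum]
      exact heq.le
  have hcost : ∀ q : Fin kv → ℝ, ∑ j, q j = 1 →
      ∑ j, C i j * q j = τ + ∑ j, (C i j - τ) * q j := by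
    intro q hq
    simp only [sub_mul, Finset.sum_sub_distrib, ← Finset.mul_sum, hq]
    ring
  constructor
  · have hseg : (1 : ℝ) ∈ segment ℝ (∑ j, (if C i j < τ then β * m j else α * m j))
        (∑ j, (if C i j ≤ τ then β * m j else α * m j)) := by
      rw [segment_eq_Icc (hthr.1.trans hthr.2)]
      exact hthr
    obtain ⟨s, t, hs, ht, hst, hsum⟩ := hseg
    have hbounds : ∀ j,
        α * m j ≤ s * (if C i j < τ then β * m j else α * m j) +
          t * (if C i j ≤ τ then β * m j else α * m j) ∧
        s * (if C i j < τ then β * m j else α * m j) +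
          t * (if C i j ≤ τ then β * m j else α * m j) ≤ β * m j := by
      intro j
      have := hab j
      obtain rfl : s = 1 - t := by linarith
      split_ifs <;> constructor <;> nlinarith
    have hone : ∑ j, (s * (if C i j < τ then β * m j else α * m j) +
        t * (if C i j ≤ τ then β * m j else α * m j)) = 1 := by
      rw [Finset.sum_add_distrib, ← Finset.mul_sum, ← Finset.mul_sum]
      exact hsum
    refine ⟨_, ⟨⟨fun j => (mul_nonneg hα0.le (hm j)).trans (hbounds j).1, hone⟩, hbounds⟩, ?_⟩
    rw [hcost _ hone]
    congr 1
    refine Finset.sum_congr rfl fun j _ => ?_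
    obtain rfl : s = 1 - t := by linarith
    rcases lt_trichotomy (C i j) τ with h | h | h
    · rw [if_pos h, if_pos h.le, max_eq_right (by linarith), max_eq_left (by linarith)]
      ring
    · simp [h]
    · rw [if_neg h.not_gt, if_neg h.not_ge, max_eq_left (by linarith), max_eq_right (by linarith)]
      ring
  · rintro x ⟨q, ⟨⟨-, hq⟩, hqb⟩, rfl⟩
    rw [hcost q hq]
    refine (add_le_add_iff_left τ).mpr (Finset.sum_le_sum fun j _ => ?_)
    obtain ⟨h1, h2⟩ : α * m j ≤ q j ∧ q j ≤ β * m j := hqb j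
    rcases le_total (C i j) τ with h | h
    · rw [max_eq_right (by linarith), max_eq_left (by linarith)]
      nlinarith
    · rw [max_eq_left (by linarith), max_eq_right (by linarith)]
      nlinarith
end

section
/- Let α = e^{-ε/2}, β = e^{ε/2}, let m ∈ ℝ_{>0}^{k_v} satisfy α Σ_j m_j ≤ 1 ≤ β Σ_j m_j, and let s ∈ ℝ_{>0}^{k_v}. Define ψ(θ) := Σ_{j=1}^{k_v} min( max( e^θ s_j, α m_j ), β m_j ). Then ψ is continuous and nondecreasing with limits α Σ_j m_j as θ → −∞ and β Σ_j m_j as θ → +∞, so there exists θ ∈ ℝ with ψ(θ) = 1; moreover, for any such θ, the vector q* with q*_j = min( max( e^θ s_j, α m_j ), β m_j ) is the unique minimizer of Σ_j q_j log(q_j / s_j) over q ∈ Q_{m,ε}. -/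
open Finset

open Filter in
theorem eventually_atBot_clip_exp_mul_eq {s a b : ℝ} (ha : 0 < a) (hab : a ≤ b) :
    ∀ᶠ θ in atBot, min (max (Real.exp θ * s) a) b = a := by
  have h : Tendsto (fun θ => Real.exp θ * s) atBot (nhds 0) := by
    simpa using Real.tendsto_exp_atBot.mul_const s
  filter_upwards [h.eventually_le_const ha] with θ hθ
  rw [max_eq_right hθ, min_eq_left hab]

open Filter in
theorem eventually_atTop_clip_exp_mul_eq {s : ℝ} (a b : ℝ) (hs : 0 < s) :
    ∀ᶠ θ in atTop, min (max (Real.exp θ * s) a) b = b := by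
  filter_upwards [(Real.tendsto_exp_atTop.atTop_mul_const hs).eventually_ge_atTop b] with θ hθ
  exact min_eq_right (hθ.trans (le_max_left _ _))

theorem sub_lt_mul_log_div {p q : ℝ} (hp : 0 < p) (hq : 0 < q) (hne : q ≠ p) :
    q - p < q * Real.log (q / p) := by
  have h := Real.log_lt_sub_one_of_pos (div_pos hp hq)
    (fun h => hne ((div_eq_one_iff_eq hq.ne').1 h).symm)
  have h' : Real.log (q / p) = -Real.log (p / q) := by rw [← Real.log_inv, inv_div]
  have h'' : q * (p / q - 1) = p - q := by field_simp
  rw [h']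
  linarith [mul_lt_mul_of_pos_left h hq]

/-- The first-order optimality condition for a clipped multiple `p` of `s` as a minimizer of
`q ↦ q log (q / s) - (θ + 1) q` on `[a, b]`. -/
theorem mul_log_div_clip_lt {θ s a b p q : ℝ} (hs : 0 < s) (ha : 0 < a)
    (hp : p = min (max (Real.exp θ * s) a) b) (haq : a ≤ q) (hqb : q ≤ b) (hne : q ≠ p) :
    p * Real.log (p / s) + (θ + 1) * (q - p) < q * Real.log (q / s) := by
  have hq : 0 < q := ha.trans_le haq
  have hp0 : 0 < p := hp ▸ lt_min (lt_max_of_lt_right ha) (hq.trans_le hqb)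
  have hlog : Real.log (q / s) = Real.log (q / p) + Real.log (p / s) := by
    rw [← Real.log_mul (div_pos hq hp0).ne' (div_pos hp0 hs).ne', div_mul_div_cancel₀ hp0.ne']
  have hsign : 0 ≤ (q - p) * (Real.log (p / s) - θ) := by
    rcases le_total p (Real.exp θ * s) with h | h
    · rcases h.eq_or_lt with h | h
      · rw [h, mul_div_cancel_right₀ _ hs.ne', Real.log_exp, sub_self, mul_zero]
      · have hpb : p = b := by grind
        have := (Real.log_le_iff_le_exp (div_pos hp0 hs)).2 ((div_le_iff₀ hs).2 h.le)
        exact mul_nonneg_of_nonpos_of_nonpos (by linarith) (by linarith)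
    · rcases h.eq_or_lt with h | h
      · rw [← h, mul_div_cancel_right₀ _ hs.ne', Real.log_exp, sub_self, mul_zero]
      · have hpa : p ≤ a := by grind
        have := (Real.le_log_iff_exp_le (div_pos hp0 hs)).2 ((le_div_iff₀ hs).2 h.le)
        exact mul_nonneg (by linarith) (by linarith)
  rw [hlog]
  linarith [sub_lt_mul_log_div hp0 hq hne]

/-- Scalar bisection for the KL projection onto the LDP polytope:
`ψ(θ) = Σ_j clip(e^θ s_j)` is continuous and nondecreasing with limits
`α Σ m` and `β Σ m`, so some `θ` achieves `ψ(θ) = 1`, and for any such `θ` the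
clipped vector is the unique minimizer of `Σ_j q_j log(q_j/s_j)` over `Q_{m,ε}`. -/
theorem bisection_kl_projection {kv : ℕ} (ε : ℝ) (hε : 0 < ε)
    (m : Fin kv → ℝ) (hm : ∀ j, 0 < m j)
    (hfeas : Real.exp (-ε / 2) * ∑ j, m j ≤ 1 ∧ 1 ≤ Real.exp (ε / 2) * ∑ j, m j)
    (s : Fin kv → ℝ) (hs : ∀ j, 0 < s j)
    (ψ : ℝ → ℝ)
    (hψ : ψ = fun θ => ∑ j,
      min (max (Real.exp θ * s j) (Real.exp (-ε / 2) * m j)) (Real.exp (ε / 2) * m j)) :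
    Continuous ψ ∧ Monotone ψ ∧
    Filter.Tendsto ψ Filter.atBot (nhds (Real.exp (-ε / 2) * ∑ j, m j)) ∧
    Filter.Tendsto ψ Filter.atTop (nhds (Real.exp (ε / 2) * ∑ j, m j)) ∧
    (∃ θ : ℝ, ψ θ = 1) ∧
    (∀ θ : ℝ, ψ θ = 1 →
      (fun j => min (max (Real.exp θ * s j) (Real.exp (-ε / 2) * m j))
          (Real.exp (ε / 2) * m j)) ∈ LDPpolytope ε m ∧
      ∀ q ∈ LDPpolytope ε m,
        (∑ j, min (max (Real.exp θ * s j) (Real.exp (-ε / 2) * m j))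
              (Real.exp (ε / 2) * m j) *
            Real.log (min (max (Real.exp θ * s j) (Real.exp (-ε / 2) * m j))
              (Real.exp (ε / 2) * m j) / s j))
          ≤ ∑ j, q j * Real.log (q j / s j) ∧
        ((∑ j, q j * Real.log (q j / s j)) ≤
            (∑ j, min (max (Real.exp θ * s j) (Real.exp (-ε / 2) * m j))
              (Real.exp (ε / 2) * m j) *
            Real.log (min (max (Real.exp θ * s j) (Real.exp (-ε / 2) * m j))
              (Real.exp (ε / 2) * m j) / s j)) →
          q = fun j => min (max (Real.exp θ * s j) (Real.exp (-ε / 2) * m j))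
            (Real.exp (ε / 2) * m j))) := by
  have ha (j) : 0 < Real.exp (-ε / 2) * m j := mul_pos (Real.exp_pos _) (hm j)
  have hab (j) : Real.exp (-ε / 2) * m j ≤ Real.exp (ε / 2) * m j :=
    mul_le_mul_of_nonneg_right (Real.exp_le_exp.2 (by linarith)) (hm j).le
  have hcont : Continuous ψ := by rw [hψ]; fun_prop
  have hmono : Monotone ψ := by
    intro x y hxy
    simp only [hψ]
    have := fun j => (hs j).le
    gcongr with j
    exact this j
  have hbot : ∀ᶠ θ in Filter.atBot, ψ θ = Real.exp (-ε / 2) * ∑ j, m j := by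
    filter_upwards [Filter.eventually_all.2 fun j =>
      eventually_atBot_clip_exp_mul_eq (s := s j) (ha j) (hab j)] with θ hθ
    simp only [hψ, hθ, mul_sum]
  have htop : ∀ᶠ θ in Filter.atTop, ψ θ = Real.exp (ε / 2) * ∑ j, m j := by
    filter_upwards [Filter.eventually_all.2 fun j =>
      eventually_atTop_clip_exp_mul_eq (Real.exp (-ε / 2) * m j) (Real.exp (ε / 2) * m j)
        (hs j)] with θ hθ
    simp only [hψ, hθ, mul_sum]
  refine ⟨hcont, hmono, tendsto_const_nhds.congr' (Filter.EventuallyEq.symm hbot),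
    tendsto_const_nhds.congr' (Filter.EventuallyEq.symm htop), ?_, ?_⟩
  · obtain ⟨x, hx⟩ := hbot.exists
    obtain ⟨y, hy⟩ := htop.exists
    exact mem_range_of_exists_le_of_exists_ge hcont ⟨x, hx.trans_le hfeas.1⟩
      ⟨y, hfeas.2.trans_eq hy.symm⟩
  intro θ hθ
  simp only [hψ] at hθ
  set p : Fin kv → ℝ := fun j => min (max (Real.exp θ * s j) (Real.exp (-ε / 2) * m j))
    (Real.exp (ε / 2) * m j) with hp
  have hap (j) : Real.exp (-ε / 2) * m j ≤ p j := le_min (le_max_right _ _) (hab j)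
  refine ⟨⟨⟨fun j => (ha j).le.trans (hap j), hθ⟩, fun j => ⟨hap j, min_le_right _ _⟩⟩, ?_⟩
  rintro q ⟨⟨-, hq1⟩, hq⟩
  change ∑ j, p j * Real.log (p j / s j) ≤ _ ∧ (_ ≤ ∑ j, p j * Real.log (p j / s j) → _)
  have hlt (j) (hne : q j ≠ p j) :=
    mul_log_div_clip_lt (hs j) (ha j) (congrFun hp j) (hq j).1 (hq j).2 hne
  have hle (j) : p j * Real.log (p j / s j) + (θ + 1) * (q j - p j) ≤
      q j * Real.log (q j / s j) := by
    by_cases h : q j = p j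
    · simp [h]
    · exact (hlt j h).le
  have hsum : ∑ j, (p j * Real.log (p j / s j) + (θ + 1) * (q j - p j)) =
      ∑ j, p j * Real.log (p j / s j) := by
    have hp1 : ∑ j, p j = 1 := hθ
    rw [sum_add_distrib, ← mul_sum, sum_sub_distrib, hq1, hp1, sub_self, mul_zero, add_zero]
  rw [← hsum]
  refine ⟨sum_le_sum fun j _ => hle j, fun hqp => ?_⟩
  contrapose! hqp
  obtain ⟨j, hj⟩ := Function.ne_iff.1 hqp
  exact sum_lt_sum (fun j _ => hle j) ⟨j, mem_univ j, hlt j hj⟩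
end

section
/- Let m ∈ ℝ_{>0}^{k_v} be entrywise positive with Q_{m,ε} nonempty. For x ∈ ℝ_{>0}^{k_v}, let Π(x) denote the unique minimizer of KL(q ∥ x) = Σ_j q_j log(q_j/x_j) over q ∈ Q_{m,ε}, and define F(x) := Π(x)/x (componentwise quotient). Then for all x, y ∈ ℝ_{>0}^{k_v}, d_H(F(x), F(y)) ≤ d_H(x, y), i.e., the map x ↦ Π(x)/x is nonexpansive in the Hilbert projective metric. -/
open Finset

/-- Hilbert projective metric on positive vectors. -/
noncomputable def hilbertDist {n : ℕ} (x y : Fin n → ℝ) : ℝ :=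
  Real.log ((⨆ i, x i / y i) / (⨅ i, x i / y i))

/-- Vector KL divergence `Σ_j q_j log(q_j/x_j)` (convention `0 · log 0 = 0`). -/
noncomputable def KLvec {n : ℕ} (q x : Fin n → ℝ) : ℝ :=
  ∑ j, q j * Real.log (q j / x j)

/-- Membership in the LDP polytope of a positive vector forces positivity. -/
theorem pos_of_mem_LDPpolytope {n : ℕ} {ε : ℝ} {m p : Fin n → ℝ} (hm : ∀ j, 0 < m j)
    (hp : p ∈ LDPpolytope ε m) (j : Fin n) : 0 < p j :=
  lt_of_lt_of_le (mul_pos (Real.exp_pos _) (hm j)) (hp.2 j).1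

/-- Tangent-line inequality for the convex function `a ↦ a * log (a / c)`. -/
theorem mul_log_div_sub_le {a b c : ℝ} (ha : 0 < a) (hb : 0 < b) (hc : 0 < c) :
    b * Real.log (b / c) - a * Real.log (a / c) ≤ (b - a) * (Real.log (b / c) + 1) := by
  have h := Real.log_le_sub_one_of_pos (div_pos hb ha)
  rw [Real.log_div hb.ne' ha.ne'] at h
  have h' := mul_le_mul_of_nonneg_left h ha.le
  have e : a * (b / a - 1) = b - a := by field_simp
  rw [e] at h'
  rw [Real.log_div hb.ne' hc.ne', Real.log_div ha.ne' hc.ne']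
  linarith

/-- First-order optimality of a KL projection `p` of `x`: when mass can be moved from
coordinate `j` to coordinate `i`, the ratio `p / x` is at least as large at `i` as at `j`. -/
theorem div_le_div_of_KLvec_minimal {n : ℕ} {ε : ℝ} {m x p : Fin n → ℝ} (hm : ∀ j, 0 < m j)
    (hx : ∀ j, 0 < x j) (hp : p ∈ LDPpolytope ε m)
    (hmin : ∀ q ∈ LDPpolytope ε m, KLvec p x ≤ KLvec q x) {i j : Fin n}
    (hi : p i < Real.exp (ε / 2) * m i) (hj : Real.exp (-ε / 2) * m j < p j) :
    p j / x j ≤ p i / x i := by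
  by_contra! hlt
  have hij : i ≠ j := by rintro rfl; exact lt_irrefl _ hlt
  have hs : 0 < x i + x j := add_pos (hx i) (hx j)
  rw [div_lt_div_iff₀ (hx i) (hx j)] at hlt
  obtain ⟨t, ht0, ht⟩ : ∃ t, 0 < t ∧ t < min (min (Real.exp (ε / 2) * m i - p i)
      (p j - Real.exp (-ε / 2) * m j)) ((p j * x i - p i * x j) / (x i + x j)) :=
    exists_between (lt_min (lt_min (sub_pos.2 hi) (sub_pos.2 hj))
      (div_pos (sub_pos.2 hlt) hs))
  rw [lt_min_iff, lt_min_iff, lt_div_iff₀ hs] at ht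
  obtain ⟨⟨hti, htj⟩, htx⟩ := ht
  have hppos := pos_of_mem_LDPpolytope hm hp
  set q : Fin n → ℝ := Function.update (Function.update p i (p i + t)) j (p j - t) with hq
  have hqi : q i = p i + t := by simp [hq, hij]
  have hqj : q j = p j - t := by simp [hq]
  have hqk : ∀ k, k ≠ i → k ≠ j → q k = p k := fun k h1 h2 => by simp [hq, h1, h2]
  have sum_sub (f g : Fin n → ℝ) (h : ∀ k, k ≠ i → k ≠ j → f k = g k) :
      ∑ k, f k - ∑ k, g k = (f i - g i) + (f j - g j) := by
    rw [← Finset.sum_sub_distrib, Finset.sum_eq_add i j hij]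
    · rintro k - ⟨h1, h2⟩
      rw [h k h1 h2, sub_self]
    · simp
    · simp
  have hbounds : ∀ k, Real.exp (-ε / 2) * m k ≤ q k ∧ q k ≤ Real.exp (ε / 2) * m k := by
    intro k
    have hk := hp.2 k
    by_cases h1 : k = i
    · subst h1; rw [hqi]; constructor <;> linarith
    by_cases h2 : k = j
    · subst h2; rw [hqj]; constructor <;> linarith
    rw [hqk k h1 h2]; exact hk
  have hqpos : ∀ k, 0 < q k := fun k =>
    lt_of_lt_of_le (mul_pos (Real.exp_pos _) (hm k)) (hbounds k).1
  have hqmem : q ∈ LDPpolytope ε m := by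
    refine ⟨⟨fun k => (hqpos k).le, ?_⟩, hbounds⟩
    have h := sum_sub q p hqk
    rw [hqi, hqj, hp.1.2] at h
    linarith
  have hdiff := sum_sub (fun k => q k * Real.log (q k / x k)) (fun k => p k * Real.log (p k / x k))
    (fun k h1 h2 => by simp only [hqk k h1 h2])
  have hle := hmin q hqmem
  unfold KLvec at hle
  have ei := mul_log_div_sub_le (hppos i) (hqpos i) (hx i)
  have ej := mul_log_div_sub_le (hppos j) (hqpos j) (hx j)
  have hlog : Real.log (q i / x i) < Real.log (q j / x j) := by
    refine Real.log_lt_log (div_pos (hqpos i) (hx i)) ?_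
    rw [div_lt_div_iff₀ (hx i) (hx j), hqi, hqj]
    linarith
  have hlog' := mul_lt_mul_of_pos_left hlog ht0
  rw [show q i - p i = t by rw [hqi]; ring] at ei
  rw [show q j - p j = -t by rw [hqj]; ring] at ej
  linarith

/-- If `p` exceeds `q` at `i` but has the same total, then it is below `q` somewhere. -/
theorem exists_lt_of_sum_eq_of_lt {n : ℕ} {p q : Fin n → ℝ} (h : ∑ k, p k = ∑ k, q k)
    {i : Fin n} (hi : q i < p i) : ∃ k, p k < q k := by
  by_contra! hle
  exact (Finset.sum_lt_sum (fun k _ => hle k) ⟨i, Finset.mem_univ i, hi⟩).ne' h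

/-- Two KL projections onto the LDP polytope: the quotient of the ratios `p / x` and `q / y`
is no larger where `p` exceeds `q` than where `p` is below `q`. -/
theorem ratio_div_ratio_le_of_KLvec_minimal {n : ℕ} {ε : ℝ} {m x y p q : Fin n → ℝ}
    (hm : ∀ j, 0 < m j) (hx : ∀ j, 0 < x j) (hy : ∀ j, 0 < y j)
    (hp : p ∈ LDPpolytope ε m) (hpmin : ∀ r ∈ LDPpolytope ε m, KLvec p x ≤ KLvec r x)
    (hq : q ∈ LDPpolytope ε m) (hqmin : ∀ r ∈ LDPpolytope ε m, KLvec q y ≤ KLvec r y)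
    {i k : Fin n} (hi : q i < p i) (hk : p k < q k) :
    p i / x i / (q i / y i) ≤ p k / x k / (q k / y k) := by
  have h1 : p i / x i ≤ p k / x k := div_le_div_of_KLvec_minimal hm hx hp hpmin
    (hk.trans_le (hq.2 k).2) ((hq.2 i).1.trans_lt hi)
  have h2 : q k / y k ≤ q i / y i := div_le_div_of_KLvec_minimal hm hy hq hqmin
    (hi.trans_le (hp.2 i).2) ((hp.2 k).1.trans_lt hk)
  exact div_le_div₀ (div_pos (pos_of_mem_LDPpolytope hm hp k) (hx k)).le h1
    (div_pos (pos_of_mem_LDPpolytope hm hq k) (hy k)) h2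

/-- Dividing `p / x` by `q / y` moves a pair with `p i ≤ q i` and `q j ≤ p j` apart by at most
the spread of `x / y` between these coordinates. -/
theorem ratio_div_ratio_le_div {a b x y a' b' x' y' : ℝ} (ha : 0 < a) (hx : 0 < x)
    (hy : 0 < y) (hb' : 0 < b') (hx' : 0 < x') (hy' : 0 < y') (hab : a ≤ b) (hab' : b' ≤ a') :
    a / x / (b / y) / (a' / x' / (b' / y')) ≤ x' / y' / (x / y) := by
  have hb := ha.trans_le hab
  have ha' := hb'.trans_le hab'
  have e : a / x / (b / y) / (a' / x' / (b' / y')) = (a / b) * (b' / a') * (x' / y' / (x / y)) := by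
    field_simp
  rw [e]
  exact mul_le_of_le_one_left (by positivity)
    (mul_le_one₀ ((div_le_one hb).2 hab) (by positivity) ((div_le_one ha').2 hab'))

/-- The Hilbert distance is controlled by pairwise comparisons of quotients. -/
theorem hilbertDist_le_of_pairwise {n : ℕ} [NeZero n] {x y u v : Fin n → ℝ}
    (hx : ∀ i, 0 < x i) (hy : ∀ i, 0 < y i) (hu : ∀ i, 0 < u i) (hv : ∀ i, 0 < v i)
    (h : ∀ i j, ∃ k l, u i / v i / (u j / v j) ≤ x k / y k / (x l / y l)) :
    hilbertDist u v ≤ hilbertDist x y := by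
  obtain ⟨i, hi⟩ := exists_eq_ciSup_of_finite (f := fun i => u i / v i)
  obtain ⟨j, hj⟩ := exists_eq_ciInf_of_finite (f := fun i => u i / v i)
  obtain ⟨b, hb⟩ := exists_eq_ciInf_of_finite (f := fun i => x i / y i)
  obtain ⟨k, l, hkl⟩ := h i j
  have hxy : ∀ i, 0 < x i / y i := fun i => div_pos (hx i) (hy i)
  have huv : ∀ i, 0 < u i / v i := fun i => div_pos (hu i) (hv i)
  unfold hilbertDist
  rw [← hi, ← hj]
  refine Real.log_le_log (div_pos (huv i) (huv j)) (hkl.trans ?_)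
  have hsup : x k / y k ≤ ⨆ i, x i / y i :=
    le_ciSup (f := fun i => x i / y i) (Set.finite_range _).bddAbove k
  have hinf : ⨅ i, x i / y i ≤ x l / y l :=
    ciInf_le (f := fun i => x i / y i) (Set.finite_range _).bddBelow l
  exact div_le_div₀ ((hxy k).le.trans hsup) hsup (hb ▸ hxy b) hinf

/-- The map `x ↦ Π(x)/x`, where `Π(x)` is the KL projection onto the
LDP polytope, is nonexpansive in the Hilbert projective metric. -/
theorem kl_projection_ratio_nonexpansive {kv : ℕ} (ε : ℝ) (hε : 0 < ε)
    (m : Fin kv → ℝ) (hm : ∀ j, 0 < m j)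
    (hQ : (LDPpolytope ε m).Nonempty)
    (Pi : (Fin kv → ℝ) → (Fin kv → ℝ))
    (hPi : ∀ x, (∀ j, 0 < x j) →
      Pi x ∈ LDPpolytope ε m ∧ ∀ q ∈ LDPpolytope ε m, KLvec (Pi x) x ≤ KLvec q x) :
    ∀ x y : Fin kv → ℝ, (∀ j, 0 < x j) → (∀ j, 0 < y j) →
      hilbertDist (fun j => Pi x j / x j) (fun j => Pi y j / y j) ≤ hilbertDist x y := by
  intro x y hx hy
  have : NeZero kv := ⟨by
    rintro rfl
    obtain ⟨ν, hν⟩ := hQ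
    simpa using hν.1.2⟩
  obtain ⟨hp, hpmin⟩ := hPi x hx
  obtain ⟨hq, hqmin⟩ := hPi y hy
  have hp0 := pos_of_mem_LDPpolytope hm hp
  have hq0 := pos_of_mem_LDPpolytope hm hq
  have hG : ∀ j, 0 < Pi x j / x j / (Pi y j / y j) := fun j =>
    div_pos (div_pos (hp0 j) (hx j)) (div_pos (hq0 j) (hy j))
  have hsum : ∑ k, Pi x k = ∑ k, Pi y k := hp.1.2.trans hq.1.2.symm
  refine hilbertDist_le_of_pairwise hx hy (fun j => div_pos (hp0 j) (hx j))
    (fun j => div_pos (hq0 j) (hy j)) fun i j => ?_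
  have hcross : ∀ k l, Pi x k ≤ Pi y k → Pi y l ≤ Pi x l →
      Pi x k / x k / (Pi y k / y k) / (Pi x l / x l / (Pi y l / y l)) ≤
        x l / y l / (x k / y k) := fun k l h1 h2 =>
    ratio_div_ratio_le_div (hp0 k) (hx k) (hy k) (hq0 l) (hx l) (hy l) h1 h2
  have hmono : ∀ {k l}, Pi y k < Pi x k → Pi x l < Pi y l →
      Pi x k / x k / (Pi y k / y k) ≤ Pi x l / x l / (Pi y l / y l) :=
    ratio_div_ratio_le_of_KLvec_minimal hm hx hy hp hpmin hq hqmin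
  rcases lt_or_ge (Pi y i) (Pi x i) with hi | hi <;>
    rcases lt_or_ge (Pi x j) (Pi y j) with hj | hj
  · refine ⟨i, i, ?_⟩
    rw [div_self (div_pos (hx i) (hy i)).ne']
    exact (div_le_one (hG j)).2 (hmono hi hj)
  · obtain ⟨k, hk⟩ := exists_lt_of_sum_eq_of_lt hsum hi
    exact ⟨j, k, (div_le_div_of_nonneg_right (hmono hi hk) (hG j).le).trans
      (hcross k j hk.le hj)⟩
  · obtain ⟨k, hk⟩ := exists_lt_of_sum_eq_of_lt hsum.symm hj
    exact ⟨k, i, (div_le_div_of_nonneg_left (hG i).le (hG k) (hmono hk hj)).trans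
      (hcross i k hi hk.le)⟩
  · exact ⟨j, i, hcross i j hi hj⟩
end

section
/- Let m ∈ ℝ_{>0}^{k_v} be entrywise positive with Q_{m,ε} nonempty. For x ∈ ℝ_{>0}^{k_v}, let Π(x) denote the unique minimizer of KL(q ∥ x) = Σ_j q_j log(q_j/x_j) over q ∈ Q_{m,ε}. Then for all x, y ∈ ℝ_{>0}^{k_v}, d_H(Π(x), Π(y)) ≤ 2 · d_H(x, y), i.e., the KL projection onto the LDP polytope is 2-Lipschitz in the Hilbert projective metric. -/
open Finset

/-- The tangent-line inequality for the convex function `q ↦ q log (q / x)`. -/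
theorem mul_log_div_sub_le_s14 {p q x : ℝ} (hp : 0 < p) (hq : 0 < q) (hx : 0 < x) :
    q * Real.log (q / x) - p * Real.log (p / x) ≤ (q - p) * (Real.log (q / x) + 1) := by
  have h := mul_le_mul_of_nonneg_left (Real.log_le_sub_one_of_pos (div_pos hq hp)) hp.le
  rw [mul_sub, mul_div_cancel₀ _ hp.ne', Real.log_div hq.ne' hp.ne'] at h
  rw [Real.log_div hq.ne' hx.ne', Real.log_div hp.ne' hx.ne']
  linarith

theorem LDPpolytope.pos {kv : ℕ} {ε : ℝ} {m q : Fin kv → ℝ} (hm : ∀ j, 0 < m j)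
    (hq : q ∈ LDPpolytope ε m) (j : Fin kv) : 0 < q j :=
  (mul_pos (Real.exp_pos _) (hm j)).trans_le (hq.2 j).1

/-- First-order optimality: a KL minimizer gains nothing by moving mass from a coordinate above
its lower bound to a coordinate below its upper bound. -/
theorem LDPpolytope.div_le_div_of_minimizer {kv : ℕ} {ε : ℝ} {m x p : Fin kv → ℝ}
    (hm : ∀ j, 0 < m j) (hx : ∀ j, 0 < x j) (hp : p ∈ LDPpolytope ε m)
    (hmin : ∀ q ∈ LDPpolytope ε m, KLvec p x ≤ KLvec q x) {i j : Fin kv}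
    (hi : Real.exp (-ε / 2) * m i < p i) (hj : p j < Real.exp (ε / 2) * m j) :
    p i / x i ≤ p j / x j := by
  rcases eq_or_ne i j with rfl | hij
  · exact le_rfl
  by_contra! hlt
  rw [div_lt_div_iff₀ (hx j) (hx i)] at hlt
  obtain ⟨t, ht, hti, htj, htx⟩ : ∃ t : ℝ, 0 < t ∧ t ≤ p i - Real.exp (-ε / 2) * m i ∧
      t ≤ Real.exp (ε / 2) * m j - p j ∧ t * (x i + x j) < p i * x j - p j * x i := by
    have hs : 0 < x i + x j := add_pos (hx i) (hx j)
    have hD : 0 < p i * x j - p j * x i := sub_pos.2 hlt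
    refine ⟨min (min (p i - Real.exp (-ε / 2) * m i) (Real.exp (ε / 2) * m j - p j))
      ((p i * x j - p j * x i) / (2 * (x i + x j))), ?_, ?_, ?_, ?_⟩
    · exact lt_min (lt_min (sub_pos.2 hi) (sub_pos.2 hj)) (by positivity)
    · exact (min_le_left _ _).trans (min_le_left _ _)
    · exact (min_le_left _ _).trans (min_le_right _ _)
    · refine (mul_le_mul_of_nonneg_right (min_le_right _ _) hs.le).trans_lt ?_
      have : (p i * x j - p j * x i) / (2 * (x i + x j)) * (x i + x j)
          = (p i * x j - p j * x i) / 2 := by field_simp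
      linarith
  set q : Fin kv → ℝ := fun k => p k + ((if k = j then t else 0) - (if k = i then t else 0))
    with hq
  have hqi : q i = p i - t := by simp [hq, hij]; ring
  have hqj : q j = p j + t := by simp [hq, hij.symm]
  have hqk : ∀ k, k ≠ i → k ≠ j → q k = p k := fun k h₁ h₂ => by simp [hq, h₁, h₂]
  have hbounds : ∀ k, Real.exp (-ε / 2) * m k ≤ q k ∧ q k ≤ Real.exp (ε / 2) * m k := by
    intro k
    have hk := hp.2 k
    by_cases hki : k = i
    · subst hki; rw [hqi]; constructor <;> linarith
    by_cases hkj : k = j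
    · subst hkj; rw [hqj]; constructor <;> linarith
    rw [hqk k hki hkj]
    exact hk
  have hqmem : q ∈ LDPpolytope ε m := by
    refine ⟨⟨fun k => ?_, ?_⟩, hbounds⟩
    · exact (mul_pos (Real.exp_pos _) (hm k)).le.trans (hbounds k).1
    · simp [hq, Finset.sum_add_distrib, Finset.sum_sub_distrib, hp.1.2]
  have hqpos := LDPpolytope.pos hm hqmem
  have hle : KLvec q x - KLvec p x ≤ t * (Real.log (q j / x j) - Real.log (q i / x i)) := by
    calc KLvec q x - KLvec p x
        ≤ ∑ k, (q k - p k) * (Real.log (q k / x k) + 1) := by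
          rw [KLvec, KLvec, ← Finset.sum_sub_distrib]
          exact Finset.sum_le_sum fun k _ =>
            mul_log_div_sub_le_s14 (LDPpolytope.pos hm hp k) (hqpos k) (hx k)
      _ = ∑ k, ((if k = j then t else 0) - (if k = i then t else 0)) *
            (Real.log (q k / x k) + 1) := by
          refine Finset.sum_congr rfl fun k _ => ?_
          congr 1
          exact add_sub_cancel_left _ _
      _ = t * (Real.log (q j / x j) - Real.log (q i / x i)) := by
          simp only [sub_mul, ite_mul, zero_mul, Finset.sum_sub_distrib, Finset.sum_ite_eq',
            Finset.mem_univ, if_true]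
          ring
  have hlog : Real.log (q j / x j) < Real.log (q i / x i) := by
    refine Real.log_lt_log (div_pos (hqpos j) (hx j)) ?_
    rw [div_lt_div_iff₀ (hx j) (hx i), hqi, hqj]
    linarith
  have := mul_neg_of_pos_of_neg ht (sub_neg.2 hlog)
  linarith [hmin q hqmem]

/-- Coordinatewise ratios of two KL projections are at most the exponential of the Hilbert
distance. -/
theorem LDPpolytope.minimizer_div_le {kv : ℕ} {ε : ℝ} {m x y p r : Fin kv → ℝ}
    (hm : ∀ j, 0 < m j) (hx : ∀ j, 0 < x j) (hy : ∀ j, 0 < y j)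
    (hp : p ∈ LDPpolytope ε m) (hpmin : ∀ q ∈ LDPpolytope ε m, KLvec p x ≤ KLvec q x)
    (hr : r ∈ LDPpolytope ε m) (hrmin : ∀ q ∈ LDPpolytope ε m, KLvec r y ≤ KLvec q y)
    {C : ℝ} (hC : ∀ i j, x i / y i ≤ C * (x j / y j)) (i : Fin kv) :
    p i ≤ C * r i := by
  have hp0 := LDPpolytope.pos hm hp
  have hr0 := LDPpolytope.pos hm hr
  rcases le_or_gt (p i) (r i) with hle | hlt
  · have hC1 : 1 ≤ C := by
      have := hC i i
      exact (le_mul_iff_one_le_left (div_pos (hx i) (hy i))).1 this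
    exact hle.trans (le_mul_of_one_le_left (hr0 i).le hC1)
  obtain ⟨j, hj⟩ : ∃ j, p j < r j := by
    by_contra! h
    have := Finset.sum_lt_sum (fun k _ => h k) ⟨i, Finset.mem_univ i, hlt⟩
    rw [hp.1.2, hr.1.2] at this
    exact lt_irrefl _ this
  have h₁ : p i / x i ≤ p j / x j := div_le_div_of_minimizer hm hx hp hpmin
    ((hr.2 i).1.trans_lt hlt) (hj.trans_le (hr.2 j).2)
  have h₂ : r j / y j ≤ r i / y i := div_le_div_of_minimizer hm hy hr hrmin
    ((hp.2 j).1.trans_lt hj) (hlt.trans_le (hp.2 i).2)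
  have hxi := hx i
  have hxj := hx j
  have hyi := hy i
  have hyj := hy j
  have hC0 : 0 < C := by
    refine pos_of_mul_pos_left ((div_pos hxi hyi).trans_le (hC i j)) (div_pos hxj hyj).le
  calc p i = x i * (p i / x i) := by field_simp
    _ ≤ x i * (p j / x j) := by gcongr
    _ ≤ x i * (r j / x j) := by gcongr
    _ = (x i / y i) * (y i * y j / x j) * (r j / y j) := by field_simp
    _ ≤ (C * (x j / y j)) * (y i * y j / x j) * (r i / y i) := by
        have := hC i j
        have := hr0 j
        gcongr
    _ = C * r i := by field_simp

/-- The KL projection onto the LDP polytope is 2-Lipschitz in the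
Hilbert projective metric. -/
theorem kl_projection_hilbert_lipschitz {kv : ℕ} (ε : ℝ) (hε : 0 < ε)
    (m : Fin kv → ℝ) (hm : ∀ j, 0 < m j)
    (hQ : (LDPpolytope ε m).Nonempty)
    (Pi : (Fin kv → ℝ) → (Fin kv → ℝ))
    (hPi : ∀ x, (∀ j, 0 < x j) →
      Pi x ∈ LDPpolytope ε m ∧ ∀ q ∈ LDPpolytope ε m, KLvec (Pi x) x ≤ KLvec q x) :
    ∀ x y : Fin kv → ℝ, (∀ j, 0 < x j) → (∀ j, 0 < y j) →
      hilbertDist (Pi x) (Pi y) ≤ 2 * hilbertDist x y := by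
  intro x y hx hy
  obtain ⟨hp, hpmin⟩ := hPi x hx
  obtain ⟨hr, hrmin⟩ := hPi y hy
  have hp0 := LDPpolytope.pos hm hp
  have hr0 := LDPpolytope.pos hm hr
  have : Nonempty (Fin kv) := by
    by_contra hne
    rw [not_nonempty_iff] at hne
    simpa using hp.1.2
  set C := (⨆ i, x i / y i) / (⨅ i, x i / y i) with hCdef
  have hinf : 0 < ⨅ i, x i / y i := by
    obtain ⟨k, hk⟩ := exists_eq_ciInf_of_finite (f := fun i => x i / y i)
    rw [← hk]
    exact div_pos (hx k) (hy k)
  have hC : ∀ i j, x i / y i ≤ C * (x j / y j) := fun i j => by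
    have hsup : x i / y i ≤ ⨆ i, x i / y i :=
      le_ciSup (f := fun i => x i / y i) (Finite.bddAbove_range _) i
    have hj : ⨅ i, x i / y i ≤ x j / y j :=
      ciInf_le (f := fun i => x i / y i) (Finite.bddBelow_range _) j
    have hpos := (div_pos (hx i) (hy i)).trans_le hsup
    calc x i / y i ≤ C * ⨅ i, x i / y i := by rwa [hCdef, div_mul_cancel₀ _ hinf.ne']
      _ ≤ C * (x j / y j) := by gcongr
  have hC' : ∀ i j, y i / x i ≤ C * (y j / x j) := fun i j => by
    have h := hC j i
    have hxi := hx i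
    have hxj := hx j
    have hyi := hy i
    have hyj := hy j
    rw [← mul_div_assoc, div_le_div_iff₀ hyj hyi] at h
    rw [← mul_div_assoc, div_le_div_iff₀ hxi hxj]
    linarith
  have hpr := LDPpolytope.minimizer_div_le hm hx hy hp hpmin hr hrmin hC
  have hrp := LDPpolytope.minimizer_div_le hm hy hx hr hrmin hp hpmin hC'
  obtain ⟨k⟩ := this
  have hC0 : 0 < C := pos_of_mul_pos_left ((hp0 k).trans_le (hpr k)) (hr0 k).le
  have : Nonempty (Fin kv) := ⟨k⟩
  obtain ⟨i, hi⟩ := exists_eq_ciSup_of_finite (f := fun i => Pi x i / Pi y i)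
  obtain ⟨j, hj⟩ := exists_eq_ciInf_of_finite (f := fun i => Pi x i / Pi y i)
  have hratio : Pi x i / Pi y i / (Pi x j / Pi y j) ≤ C ^ 2 := by
    have h₁ : Pi x i / Pi y i ≤ C := (div_le_iff₀ (hr0 i)).2 (hpr i)
    have h₂ : Pi y j / Pi x j ≤ C := (div_le_iff₀ (hp0 j)).2 (hrp j)
    rw [div_eq_mul_inv, inv_div, sq]
    exact mul_le_mul h₁ h₂ (div_pos (hr0 j) (hp0 j)).le hC0.le
  have hpos : 0 < Pi x i / Pi y i / (Pi x j / Pi y j) :=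
    div_pos (div_pos (hp0 i) (hr0 i)) (div_pos (hp0 j) (hr0 j))
  have h := Real.log_le_log hpos hratio
  rw [Real.log_pow] at h
  rw [hilbertDist, hilbertDist, ← hi, ← hj]
  exact_mod_cast h
end

section
/- Let α = e^{-ε/2}, β = e^{ε/2}, let D_p := max_{i,j} C_{ij}, and for m ∈ ℝ_{≥0}^{k_v} with Q_{m,ε} nonempty define φ_i(m) := min { Σ_{j=1}^{k_v} C_{ij} q_j : q ∈ Q_{m,ε} }. Then for every i ∈ [k] and all m, m' ∈ ℝ_{≥0}^{k_v} with Q_{m,ε} and Q_{m',ε} both nonempty, |φ_i(m) − φ_i(m')| ≤ β D_p · ‖m − m'‖_1; consequently, the function f(m) := max_{i∈[k]} φ_i(m) satisfies |f(m) − f(m')| ≤ β D_p · ‖m − m'‖_1. -/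
open Finset

/-- The optimal projection cost `φ_i(m)` of the Dirac at `i` onto the LDP polytope. -/
noncomputable def phiCost {k kv : ℕ} (ε : ℝ) (C : Fin k → Fin kv → ℝ)
    (i : Fin k) (m : Fin kv → ℝ) : ℝ :=
  sInf {x | ∃ q ∈ LDPpolytope ε m, x = ∑ j, C i j * q j}

/-- Between two vectors whose sums straddle `1` lies a vector with sum `1`. -/
theorem exists_sum_eq_one_between {ι : Type*} [Fintype ι] {a b : ι → ℝ} (hab : ∀ j, a j ≤ b j)
    (ha : ∑ j, a j ≤ 1) (hb : 1 ≤ ∑ j, b j) :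
    ∃ q : ι → ℝ, (∀ j, a j ≤ q j ∧ q j ≤ b j) ∧ ∑ j, q j = 1 := by
  have hcont : ContinuousOn (fun t : ℝ => ∑ j, (a j + t * (b j - a j))) (Set.Icc 0 1) := by
    fun_prop
  obtain ⟨t, ⟨ht0, ht1⟩, ht⟩ := intermediate_value_Icc zero_le_one hcont
    (show (1 : ℝ) ∈ Set.Icc _ _ by simpa using ⟨ha, hb⟩)
  refine ⟨fun j => a j + t * (b j - a j), fun j => ⟨?_, ?_⟩, ht⟩ <;>
    nlinarith [hab j]

/-- A point of one LDP polytope can be moved into another at a cost controlled by the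
`ℓ¹` distance between the reference vectors. -/
theorem exists_mem_LDPpolytope_cost_le {kv : ℕ} {ε : ℝ} (hε : 0 ≤ ε) {c : Fin kv → ℝ} {D : ℝ}
    (hc : ∀ j, 0 ≤ c j) (hcD : ∀ j, c j ≤ D) {m m' : Fin kv → ℝ} (hm' : ∀ j, 0 ≤ m' j)
    (hQ' : (LDPpolytope ε m').Nonempty) {q : Fin kv → ℝ} (hq : q ∈ LDPpolytope ε m) :
    ∃ q' ∈ LDPpolytope ε m',
      ∑ j, c j * q' j ≤ ∑ j, c j * q j + Real.exp (ε / 2) * D * ∑ j, |m j - m' j| := by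
  obtain ⟨r, ⟨-, hr1⟩, hr⟩ := hQ'
  obtain ⟨⟨-, hq1⟩, hqm⟩ := hq
  have hα0 : 0 < Real.exp (-ε / 2) := Real.exp_pos _
  have hαβ : Real.exp (-ε / 2) ≤ Real.exp (ε / 2) := Real.exp_le_exp.2 (by linarith)
  unfold LDPpolytope IsProbVec
  generalize Real.exp (-ε / 2) = α at *
  generalize Real.exp (ε / 2) = β at *
  have hlo : ∑ j, α * m' j ≤ 1 := hr1 ▸ sum_le_sum fun j _ => (hr j).1
  have hhi : 1 ≤ ∑ j, β * m' j := hr1 ▸ sum_le_sum fun j _ => (hr j).2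
  set p : Fin kv → ℝ := fun j => max (α * m' j) (min (q j) (β * m' j))
  have hαp : ∀ j, α * m' j ≤ p j := fun j => le_max_left _ _
  have hpβ : ∀ j, p j ≤ β * m' j := fun j =>
    max_le (mul_le_mul_of_nonneg_right hαβ (hm' j)) (min_le_right _ _)
  have hpq : ∀ j, p j - q j ≤ β * |m j - m' j| := by
    intro j
    have h0 : 0 ≤ β * |m j - m' j| := mul_nonneg (hα0.le.trans hαβ) (abs_nonneg _)
    have h1 : α * (m' j - m j) ≤ β * |m j - m' j| :=
      (mul_le_mul_of_nonneg_left (abs_sub_comm (m j) (m' j) ▸ le_abs_self _) hα0.le).trans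
        (mul_le_mul_of_nonneg_right hαβ (abs_nonneg _))
    have h2 : p j ≤ q j + β * |m j - m' j| :=
      max_le (by linarith [(hqm j).1]) ((min_le_left _ _).trans (by linarith))
    linarith
  have hqp : ∀ j, q j - p j ≤ β * |m j - m' j| := by
    intro j
    have h0 : 0 ≤ β * |m j - m' j| := mul_nonneg (hα0.le.trans hαβ) (abs_nonneg _)
    have h1 : β * (m j - m' j) ≤ β * |m j - m' j| :=
      mul_le_mul_of_nonneg_left (le_abs_self _) (hα0.le.trans hαβ)
    have h2 : q j - β * |m j - m' j| ≤ p j :=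
      le_max_of_le_right (le_min (by linarith) (by linarith [(hqm j).2]))
    linarith
  have hE : ∀ j, 0 ≤ β * |m j - m' j| := fun j =>
    mul_nonneg (hα0.le.trans hαβ) (abs_nonneg _)
  rcases le_total 1 (∑ j, p j) with h | h
  · obtain ⟨q', hq', hq'1⟩ := exists_sum_eq_one_between hαp hlo h
    refine ⟨q', ⟨⟨fun j => (mul_nonneg hα0.le (hm' j)).trans (hq' j).1, hq'1⟩,
      fun j => ⟨(hq' j).1, (hq' j).2.trans (hpβ j)⟩⟩, ?_⟩
    rw [mul_sum, ← sum_add_distrib]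
    refine sum_le_sum fun j _ => ?_
    have h1 : c j * (q' j - q j) ≤ c j * (β * |m j - m' j|) :=
      mul_le_mul_of_nonneg_left (by linarith [(hq' j).2, hpq j]) (hc j)
    have h2 := mul_le_mul_of_nonneg_right (hcD j) (hE j)
    linarith
  · obtain ⟨q', hq', hq'1⟩ := exists_sum_eq_one_between hpβ h hhi
    refine ⟨q', ⟨⟨fun j => (mul_nonneg hα0.le (hm' j)).trans ((hαp j).trans (hq' j).1), hq'1⟩,
      fun j => ⟨(hαp j).trans (hq' j).1, (hq' j).2⟩⟩, ?_⟩
    have key : ∑ j, (D - c j) * (q j - q' j) ≤ ∑ j, β * D * |m j - m' j| := by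
      refine sum_le_sum fun j _ => ?_
      have h1 : (D - c j) * (q j - q' j) ≤ (D - c j) * (β * |m j - m' j|) :=
        mul_le_mul_of_nonneg_left (by linarith [(hq' j).1, hqp j]) (by linarith [hcD j])
      have h2 := mul_nonneg (hc j) (hE j)
      linarith
    have expand : ∑ j, (D - c j) * (q j - q' j) =
        D * ∑ j, q j - D * ∑ j, q' j - ∑ j, c j * q j + ∑ j, c j * q' j := by
      simp only [mul_sum, ← sum_sub_distrib, ← sum_add_distrib]
      exact sum_congr rfl fun j _ => by ring
    rw [expand, hq1, hq'1, ← mul_sum] at key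
    linarith

theorem phiCost_le_add {k kv : ℕ} {ε : ℝ} (hε : 0 ≤ ε) {C : Fin k → Fin kv → ℝ}
    (hC : ∀ i j, 0 ≤ C i j) {D : ℝ} (hCD : ∀ i j, C i j ≤ D) {m m' : Fin kv → ℝ}
    (hm' : ∀ j, 0 ≤ m' j) (hQm : (LDPpolytope ε m).Nonempty)
    (hQm' : (LDPpolytope ε m').Nonempty) (i : Fin k) :
    phiCost ε C i m' ≤ phiCost ε C i m + Real.exp (ε / 2) * D * ∑ j, |m j - m' j| := by
  rw [← sub_le_iff_le_add]
  obtain ⟨r, hr⟩ := hQm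
  refine le_csInf ⟨_, r, hr, rfl⟩ ?_
  rintro _ ⟨q, hq, rfl⟩
  obtain ⟨q', hq', hle⟩ := exists_mem_LDPpolytope_cost_le hε (hC i) (hCD i) hm' hQm' hq
  rw [sub_le_iff_le_add]
  refine le_trans (csInf_le ⟨0, ?_⟩ ⟨q', hq', rfl⟩) hle
  rintro _ ⟨p, hp, rfl⟩
  exact sum_nonneg fun j _ => mul_nonneg (hC i j) (hp.1.1 j)

/-- Each `φ_i` is `β D_p`-Lipschitz in `m` with respect to the ℓ¹ norm
(where `β = e^{ε/2}` and `D_p = max_{i,j} C_{ij}`), and consequently so is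
`f(m) = max_i φ_i(m)`. -/
theorem phiCost_lipschitz {k kv : ℕ} (hk : 0 < k) (ε : ℝ) (hε : 0 < ε)
    (C : Fin k → Fin kv → ℝ) (hC : ∀ i j, 0 ≤ C i j)
    (m m' : Fin kv → ℝ) (hm : ∀ j, 0 ≤ m j) (hm' : ∀ j, 0 ≤ m' j)
    (hQm : (LDPpolytope ε m).Nonempty) (hQm' : (LDPpolytope ε m').Nonempty) :
    (∀ i : Fin k, |phiCost ε C i m - phiCost ε C i m'| ≤
      Real.exp (ε / 2) * (⨆ i, ⨆ j, C i j) * ∑ j, |m j - m' j|) ∧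
    |(⨆ i, phiCost ε C i m) - (⨆ i, phiCost ε C i m')| ≤
      Real.exp (ε / 2) * (⨆ i, ⨆ j, C i j) * ∑ j, |m j - m' j| := by
  have hCD : ∀ i j, C i j ≤ ⨆ i, ⨆ j, C i j := fun i j =>
    (le_ciSup (Set.finite_range (C i)).bddAbove j).trans
      (le_ciSup (f := fun i => ⨆ j, C i j) (Set.finite_range _).bddAbove i)
  have h₁ := phiCost_le_add hε.le hC hCD hm' hQm hQm'
  have h₂ := phiCost_le_add hε.le hC hCD hm hQm' hQm
  simp only [abs_sub_comm (m' _)] at h₂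
  have : Nonempty (Fin k) := ⟨⟨0, hk⟩⟩
  have hle : ∀ (x : Fin kv → ℝ) i, phiCost ε C i x ≤ ⨆ i, phiCost ε C i x := fun x i =>
    le_ciSup (f := fun i => phiCost ε C i x) (Set.finite_range _).bddAbove i
  refine ⟨fun i => abs_sub_le_iff.2 ⟨by linarith [h₂ i], by linarith [h₁ i]⟩,
    abs_sub_le_iff.2 ⟨?_, ?_⟩⟩ <;> rw [sub_le_iff_le_add]
  · exact ciSup_le fun i => by linarith [h₂ i, hle m' i]
  · exact ciSup_le fun i => by linarith [h₁ i, hle m i]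
end

section
/- Fix an integer d ≥ 2, a real p ≥ 1, and ε > 0. Let A := e^{ε/2} − e^{-ε/2}, B := e^{-ε/2}, C_d := Γ((d+1)/2)/(√π · Γ(d/2)), f_d(u) := C_d (1−u²)^{(d−2)/2}, g(u) := (2−2u)^{p/2}, S(t) := ∫_t^1 f_d(u) du, U(t) := ∫_t^1 g(u) f_d(u) du, H := ∫_{−1}^1 g(u) f_d(u) du, and G(t) := A·U(t) + B·H − g(t)·(B + A·S(t)) for t ∈ (−1, 1). Then G is strictly increasing on (−1, 1), satisfies lim_{t↓−1} G(t) = (A+B)(H − 2^p) < 0 and lim_{t↑1} G(t) = B·H > 0, and hence there exists a unique t* ∈ (−1, 1) with G(t*) = 0. -/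
open Real Set Filter

/-- Density of the inner product `⟨x, y⟩` for `y` uniform on the sphere `S^d`. -/
noncomputable def sphereDensity (d : ℕ) (u : ℝ) : ℝ :=
  (Real.Gamma (((d : ℝ) + 1) / 2) / (Real.sqrt π * Real.Gamma ((d : ℝ) / 2))) *
    (1 - u ^ 2) ^ (((d : ℝ) - 2) / 2)

/-- `g(u) = ‖x − y‖₂^p` expressed via `u = ⟨x, y⟩`. -/
noncomputable def gCost (p u : ℝ) : ℝ := (2 - 2 * u) ^ (p / 2)

/-- `S(t) = ∫_t^1 f_d(u) du`. -/
noncomputable def capMass (d : ℕ) (t : ℝ) : ℝ := ∫ u in t..1, sphereDensity d u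

/-- `U(t) = ∫_t^1 g(u) f_d(u) du`. -/
noncomputable def capCost (d : ℕ) (p t : ℝ) : ℝ := ∫ u in t..1, gCost p u * sphereDensity d u

/-- `H = ∫_{−1}^1 g(u) f_d(u) du`. -/
noncomputable def totalCost (d : ℕ) (p : ℝ) : ℝ := ∫ u in (-1 : ℝ)..1, gCost p u * sphereDensity d u

lemma integral_rpow_mul_one_sub_rpow {a b : ℝ} (ha : 0 < a) (hb : 0 < b) :
    ∫ x in (0 : ℝ)..1, x ^ (a - 1) * (1 - x) ^ (b - 1) =
      Real.Gamma a * Real.Gamma b / Real.Gamma (a + b) := by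
  have h := ProbabilityTheory.beta_eq_betaIntegralReal a b ha hb
  rw [ProbabilityTheory.beta] at h
  rw [h, Complex.betaIntegral]
  have key : ∫ x in (0 : ℝ)..1, (x : ℂ) ^ ((a : ℂ) - 1) * (1 - (x : ℂ)) ^ ((b : ℂ) - 1) =
      ∫ x in (0 : ℝ)..1, ((x ^ (a - 1) * (1 - x) ^ (b - 1) : ℝ) : ℂ) := by
    refine intervalIntegral.integral_congr fun x hx => ?_
    rw [uIcc_of_le zero_le_one] at hx
    have h1 : 0 ≤ 1 - x := by linarith [hx.2]
    rw [Complex.ofReal_mul, Complex.ofReal_cpow hx.1, Complex.ofReal_cpow h1]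
    push_cast
    rfl
  rw [key, intervalIntegral.integral_ofReal, Complex.ofReal_re]

lemma integral_one_sub_sq_rpow {s : ℝ} (hs : 0 < s) :
    ∫ u in (-1 : ℝ)..1, (1 - u ^ 2) ^ (s - 1) =
      √π * Real.Gamma s / Real.Gamma (s + 1 / 2) := by
  have hsub := intervalIntegral.smul_integral_comp_mul_sub (a := (0 : ℝ)) (b := 1)
    (fun u : ℝ => (1 - u ^ 2) ^ (s - 1)) 2 1
  norm_num at hsub
  have hcongr : ∫ x in (0 : ℝ)..1, (1 - (2 * x - 1) ^ 2) ^ (s - 1) =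
      ∫ x in (0 : ℝ)..1, (4 : ℝ) ^ (s - 1) * (x ^ (s - 1) * (1 - x) ^ (s - 1)) := by
    refine intervalIntegral.integral_congr fun x hx => ?_
    rw [uIcc_of_le zero_le_one] at hx
    have h1 : 0 ≤ 1 - x := by linarith [hx.2]
    rw [← Real.mul_rpow hx.1 h1, ← Real.mul_rpow (by norm_num) (mul_nonneg hx.1 h1)]
    congr 1
    ring
  rw [← hsub, hcongr, intervalIntegral.integral_const_mul, integral_rpow_mul_one_sub_rpow hs hs]
  have hdup := Real.Gamma_mul_Gamma_add_half s
  have h2 : (2 : ℝ) * 4 ^ (s - 1) * 2 ^ (1 - 2 * s) = 1 := by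
    rw [show (4 : ℝ) = 2 ^ (2 : ℝ) by norm_num, ← Real.rpow_mul (by norm_num)]
    nth_rewrite 1 [← Real.rpow_one 2]
    rw [← Real.rpow_add (by norm_num), ← Real.rpow_add (by norm_num)]
    ring_nf
    exact Real.rpow_zero 2
  have hG2 := (Real.Gamma_pos_of_pos (show 0 < s + 1 / 2 by linarith)).ne'
  have hG3 := (Real.Gamma_pos_of_pos (show 0 < 2 * s by linarith)).ne'
  rw [← two_mul s, eq_div_iff hG2]
  have : 2 * (4 ^ (s - 1) * (Real.Gamma s * Real.Gamma s / Real.Gamma (2 * s))) *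
      Real.Gamma (s + 1 / 2) = 2 * 4 ^ (s - 1) * Real.Gamma s *
        (Real.Gamma s * Real.Gamma (s + 1 / 2)) / Real.Gamma (2 * s) := by
    ring
  rw [this, hdup, div_eq_iff hG3]
  linear_combination (√π * Real.Gamma s * Real.Gamma (2 * s)) * h2

lemma continuous_sphereDensity {d : ℕ} (hd : 2 ≤ d) : Continuous (sphereDensity d) := by
  have h : (2 : ℝ) ≤ d := by exact_mod_cast hd
  unfold sphereDensity
  exact continuous_const.mul
    ((by fun_prop : Continuous fun u : ℝ => 1 - u ^ 2).rpow_const fun _ => Or.inr (by linarith))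

lemma sphereDensity_pos {d : ℕ} (hd : 0 < d) {u : ℝ} (hu : u ∈ Ioo (-1 : ℝ) 1) :
    0 < sphereDensity d u := by
  have h : (0 : ℝ) < d := by exact_mod_cast hd
  have h1 := Real.Gamma_pos_of_pos (show 0 < ((d : ℝ) + 1) / 2 by linarith)
  have h2 := Real.Gamma_pos_of_pos (show 0 < (d : ℝ) / 2 by linarith)
  have h3 : 0 < 1 - u ^ 2 := by nlinarith [hu.1, hu.2]
  unfold sphereDensity
  positivity

lemma capMass_neg_one {d : ℕ} (hd : 0 < d) : capMass d (-1) = 1 := by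
  have h : (0 : ℝ) < d := by exact_mod_cast hd
  have h1 := (Real.Gamma_pos_of_pos (show 0 < ((d : ℝ) + 1) / 2 by linarith)).ne'
  have h2 := (Real.Gamma_pos_of_pos (show 0 < (d : ℝ) / 2 by linarith)).ne'
  have h3 : √π ≠ 0 := (Real.sqrt_pos.2 Real.pi_pos).ne'
  have hint := integral_one_sub_sq_rpow (show 0 < (d : ℝ) / 2 by linarith)
  rw [show (d : ℝ) / 2 - 1 = (d - 2) / 2 by ring,
    show (d : ℝ) / 2 + 1 / 2 = (d + 1) / 2 by ring] at hint
  simp only [capMass, sphereDensity]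
  rw [intervalIntegral.integral_const_mul, hint]
  field_simp

lemma continuous_gCost {p : ℝ} (hp : 0 ≤ p) : Continuous (gCost p) := by
  unfold gCost
  exact (by fun_prop : Continuous fun u : ℝ => 2 - 2 * u).rpow_const fun _ => Or.inr (by linarith)

lemma gCost_strictAntiOn {p : ℝ} (hp : 0 < p) : StrictAntiOn (gCost p) (Iic 1) := by
  intro x _ y hy hxy
  have hy' : y ≤ 1 := hy
  exact Real.rpow_lt_rpow (by linarith) (by linarith) (by linarith)

lemma gCost_pos {p u : ℝ} (hu : u < 1) : 0 < gCost p u :=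
  Real.rpow_pos_of_pos (by linarith) _

lemma gCost_neg_one (p : ℝ) : gCost p (-1) = 2 ^ p := by
  rw [gCost, show (2 : ℝ) - 2 * -1 = 2 ^ (2 : ℝ) by norm_num, ← Real.rpow_mul (by norm_num)]
  congr 1
  ring

lemma gCost_one {p : ℝ} (hp : 0 < p) : gCost p 1 = 0 := by
  rw [gCost, show (2 : ℝ) - 2 * 1 = 0 by norm_num, Real.zero_rpow (by linarith)]

lemma totalCost_pos {d : ℕ} (hd : 2 ≤ d) {p : ℝ} (hp : 0 ≤ p) : 0 < totalCost d p :=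
  intervalIntegral.intervalIntegral_pos_of_pos_on
    (((continuous_gCost hp).mul (continuous_sphereDensity hd)).intervalIntegrable _ _)
    (fun _ hu => mul_pos (gCost_pos hu.2) (sphereDensity_pos (by omega) hu)) (by norm_num)

lemma totalCost_lt {d : ℕ} (hd : 2 ≤ d) {p : ℝ} (hp : 0 < p) : totalCost d p < 2 ^ p := by
  have hf := continuous_sphereDensity hd
  have hgf : Continuous fun u => gCost p u * sphereDensity d u := (continuous_gCost hp.le).mul hf
  have hconst : Continuous fun u => (2 : ℝ) ^ p * sphereDensity d u := continuous_const.mul hf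
  have hpos : 0 < ∫ u in (-1 : ℝ)..1,
      (2 ^ p * sphereDensity d u - gCost p u * sphereDensity d u) := by
    refine intervalIntegral.intervalIntegral_pos_of_pos_on
      ((hconst.sub hgf).intervalIntegrable _ _) (fun u hu => ?_) (by norm_num)
    have hg : gCost p u < gCost p (-1) :=
      gCost_strictAntiOn hp (by norm_num) hu.2.le hu.1
    rw [gCost_neg_one] at hg
    rw [← sub_mul]
    exact mul_pos (sub_pos.2 hg) (sphereDensity_pos (by omega) hu)
  rw [intervalIntegral.integral_sub (hconst.intervalIntegrable _ _) (hgf.intervalIntegrable _ _),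
    intervalIntegral.integral_const_mul] at hpos
  have hS := capMass_neg_one (d := d) (by omega)
  rw [capMass] at hS
  rw [hS] at hpos
  rw [totalCost]
  linarith

lemma continuous_integral_to_one {f : ℝ → ℝ} (hf : Continuous f) :
    Continuous fun t : ℝ => ∫ u in t..1, f u := by
  simp only [intervalIntegral.integral_symm 1]
  exact (intervalIntegral.continuous_primitive (fun _ _ => hf.intervalIntegrable _ _) 1).neg

lemma capMass_nonneg {d : ℕ} (hd : 0 < d) {t : ℝ} (ht : t ∈ Ioo (-1 : ℝ) 1) :
    0 ≤ capMass d t := by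
  rw [capMass, intervalIntegral.integral_of_le ht.2.le, MeasureTheory.integral_Ioc_eq_integral_Ioo]
  exact MeasureTheory.setIntegral_nonneg measurableSet_Ioo fun u hu =>
    (sphereDensity_pos hd ⟨ht.1.trans hu.1, hu.2⟩).le

lemma capCost_sub_le {d : ℕ} (hd : 2 ≤ d) {p : ℝ} (hp : 0 < p) {s t : ℝ}
    (hs : -1 < s) (hst : s ≤ t) (ht : t < 1) :
    capCost d p s - capCost d p t ≤ gCost p s * (capMass d s - capMass d t) := by
  have hf := continuous_sphereDensity hd
  have hgf : Continuous fun u => gCost p u * sphereDensity d u := (continuous_gCost hp.le).mul hf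
  have hconst : Continuous fun u => gCost p s * sphereDensity d u := continuous_const.mul hf
  have hU : capCost d p s - capCost d p t = ∫ u in s..t, gCost p u * sphereDensity d u := by
    rw [capCost, capCost, sub_eq_iff_eq_add,
      intervalIntegral.integral_add_adjacent_intervals (hgf.intervalIntegrable _ _)
        (hgf.intervalIntegrable _ _)]
  have hS : capMass d s - capMass d t = ∫ u in s..t, sphereDensity d u := by
    rw [capMass, capMass, sub_eq_iff_eq_add,
      intervalIntegral.integral_add_adjacent_intervals (hf.intervalIntegrable _ _)
        (hf.intervalIntegrable _ _)]
  rw [hU, hS, ← intervalIntegral.integral_const_mul]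
  refine intervalIntegral.integral_mono_on hst (hgf.intervalIntegrable _ _)
    (hconst.intervalIntegrable _ _) fun u hu => ?_
  refine mul_le_mul_of_nonneg_right ?_
    (sphereDensity_pos (by omega) ⟨hs.trans_le hu.1, hu.2.trans_lt ht⟩).le
  exact (gCost_strictAntiOn hp).antitoneOn (hst.trans ht.le) (hu.2.trans ht.le) hu.1

/-- The optimality function
`G(t) = A·U(t) + B·H − g(t)·(B + A·S(t))` is strictly increasing on `(−1, 1)`,
tends to `(A+B)(H − 2^p) < 0` as `t ↓ −1` and to `B·H > 0` as `t ↑ 1`, and hence has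
a unique zero `t* ∈ (−1, 1)`. -/
theorem sphere_threshold_unique (d : ℕ) (hd : 2 ≤ d) (p : ℝ) (hp : 1 ≤ p)
    (ε : ℝ) (hε : 0 < ε)
    (A B : ℝ) (hA : A = Real.exp (ε / 2) - Real.exp (-ε / 2))
    (hB : B = Real.exp (-ε / 2))
    (G : ℝ → ℝ)
    (hG : G = fun t => A * capCost d p t + B * totalCost d p -
      gCost p t * (B + A * capMass d t)) :
    StrictMonoOn G (Ioo (-1 : ℝ) 1) ∧
    Tendsto G (nhdsWithin (-1 : ℝ) (Ioi (-1 : ℝ)))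
      (nhds ((A + B) * (totalCost d p - (2 : ℝ) ^ p))) ∧
    (A + B) * (totalCost d p - (2 : ℝ) ^ p) < 0 ∧
    Tendsto G (nhdsWithin (1 : ℝ) (Iio (1 : ℝ))) (nhds (B * totalCost d p)) ∧
    0 < B * totalCost d p ∧
    ∃! t : ℝ, t ∈ Ioo (-1 : ℝ) 1 ∧ G t = 0 := by
  have hp0 : 0 < p := by linarith
  have hB0 : 0 < B := hB ▸ Real.exp_pos _
  have hA0 : 0 < A := by
    rw [hA, sub_pos, Real.exp_lt_exp]
    linarith
  have hH := totalCost_pos hd hp0.le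
  have hH' := totalCost_lt hd hp0
  have hf := continuous_sphereDensity hd
  have hg := continuous_gCost hp0.le
  have hS : Continuous (capMass d) := continuous_integral_to_one hf
  have hU : Continuous (capCost d p) := continuous_integral_to_one (hg.mul hf)
  have hcont : Continuous G := by
    rw [hG]
    fun_prop
  have hleft : G (-1) = (A + B) * (totalCost d p - (2 : ℝ) ^ p) := by
    have hUH : capCost d p (-1) = totalCost d p := rfl
    simp only [hG, hUH, gCost_neg_one, capMass_neg_one (show 0 < d by omega)]
    ring
  have hright : G 1 = B * totalCost d p := by
    simp [hG, gCost_one hp0, capCost]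
  have hmono : StrictMonoOn G (Ioo (-1 : ℝ) 1) := by
    intro s hs t ht hst
    have hUS := capCost_sub_le hd hp0 hs.1 hst.le ht.2
    have hgst : gCost p t < gCost p s := gCost_strictAntiOn hp0 hs.2.le ht.2.le hst
    have hSt := capMass_nonneg (d := d) (by omega) ht
    have hweight : 0 < B + A * capMass d t := by positivity
    have h1 := mul_lt_mul_of_pos_right hgst hweight
    have h2 := mul_le_mul_of_nonneg_left hUS hA0.le
    simp only [hG]
    linarith
  have hneg : (A + B) * (totalCost d p - (2 : ℝ) ^ p) < 0 :=
    mul_neg_of_pos_of_neg (by positivity) (by linarith)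
  have hpos : 0 < B * totalCost d p := mul_pos hB0 hH
  refine ⟨hmono, hleft ▸ hcont.continuousAt.tendsto.mono_left nhdsWithin_le_nhds, hneg,
    hright ▸ hcont.continuousAt.tendsto.mono_left nhdsWithin_le_nhds, hpos, ?_⟩
  obtain ⟨t, ht, ht0⟩ := intermediate_value_Ioo (by norm_num) hcont.continuousOn
    (show (0 : ℝ) ∈ Ioo (G (-1)) (G 1) from ⟨hleft ▸ hneg, hright ▸ hpos⟩)
  exact ⟨t, ⟨ht, ht0⟩, fun s hs => hmono.injOn hs.1 ht (hs.2.trans ht0.symm)⟩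
end
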